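/- arXiv:1211.5217 — 3 statements merged into one kernel-verified Lean document; each statement's English description precedes it below -/
import Mathlib

section
/- Let a, b > 0 with a − 2b > 0, let η ∈ (0, √(a−b) − √(a/2)), let φ_η be an admissible cutoff, and let (f_{x,η}, g_{x,η}) be the solution of the regularized system with f_{x,η}(0) = 0, g_{x,η}(0) = x, on its maximal interval [0, R_{x,η}). If x² ≤ 1, then g_{x,η}(r)² ≤ 1 and f_{x,η}(r)² ≤ a − b for all r ∈ [0, R_{x,η}), the solution is global (R_{x,η} = +∞), and (f_{x,η}(r), g_{x,η}(r)) ∈ 𝒜 for all r ∈ [0, +∞). If moreover x² < 1, then (f_{x,η}(r), g_{x,η}(r)) lies in the interior of 𝒜 for all r ∈ [0, +∞). -/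
open Real Set Filter Topology

noncomputable section

/-- The Hamiltonian energy `H(f,g) = ½ f²(1−g²) + (a/4) g⁴ − (b/2) g²`. -/
def Ham (a b f g : ℝ) : ℝ := 1 / 2 * f ^ 2 * (1 - g ^ 2) + a / 4 * g ^ 4 - b / 2 * g ^ 2

/-- The set `𝒜` of admissible points. -/
def Aadm (a b : ℝ) : Set (ℝ × ℝ) :=
  {p | 2 * p.1 ^ 2 - a * p.2 ^ 2 - (a - 2 * b) ≤ 0 ∧ p.2 ^ 2 ≤ 1}

/-- `φ` is an admissible cutoff function `φ_η`. -/
def IsCutoff (a b η : ℝ) (φ : ℝ → ℝ → ℝ) : Prop :=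
  (∀ f g, φ f g ∈ Icc (0 : ℝ) 1) ∧
  ContDiffOn ℝ (⊤ : ℕ∞) (fun p : ℝ × ℝ => φ p.1 p.2)
    (Ioo (-Real.sqrt (a - b)) (Real.sqrt (a - b)) ×ˢ (univ : Set ℝ)) ∧
  (∀ f g, φ f g = φ |f| |g|) ∧
  (∀ f g, Real.sqrt (a - b) - η / 2 ≤ |f| → φ f g = 0) ∧
  (∀ f g, |f| ≤ Real.sqrt (a - b) - η → φ f g = 1)

/-- `(f, g)` is a `C¹` solution on `s` of the original Cauchy problem
`f' + (2/r) f = g(f² − a g² + b)`, `g' = f(1 − g²)`, `f(0) = 0`, `g(0) = x`. -/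
def IsSolOn (a b x : ℝ) (f g : ℝ → ℝ) (s : Set ℝ) : Prop :=
  f 0 = 0 ∧ g 0 = x ∧ ContinuousOn f s ∧ ContinuousOn g s ∧
  ∀ r ∈ s, 0 < r →
    HasDerivAt f (g r * ((f r) ^ 2 - a * (g r) ^ 2 + b) - 2 / r * f r) r ∧
    HasDerivAt g (f r * (1 - (g r) ^ 2)) r

/-- `(f, g)` is a `C¹` solution on `s` of the regularized Cauchy problem
`f' + (2 φ(f,g)/r) f = g(f² − a g² + b)`, `g' = f(1 − g²)`, `f(0) = 0`, `g(0) = x`. -/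
def IsRegSolOn (a b : ℝ) (φ : ℝ → ℝ → ℝ) (x : ℝ) (f g : ℝ → ℝ) (s : Set ℝ) : Prop :=
  f 0 = 0 ∧ g 0 = x ∧ ContinuousOn f s ∧ ContinuousOn g s ∧
  ∀ r ∈ s, 0 < r →
    HasDerivAt f (g r * ((f r) ^ 2 - a * (g r) ^ 2 + b) - 2 * φ (f r) (g r) / r * f r) r ∧
    HasDerivAt g (f r * (1 - (g r) ^ 2)) r

/-- `(f, g)` is a solution on `s` of the autonomous (Hamiltonian) system
`f' = g(f² − a g² + b)`, `g' = f(1 − g²)` with initial data `(fi, gi)`. -/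
def IsAutSolOn (a b fi gi : ℝ) (f g : ℝ → ℝ) (s : Set ℝ) : Prop :=
  f 0 = fi ∧ g 0 = gi ∧ ContinuousOn f s ∧ ContinuousOn g s ∧
  ∀ r ∈ s,
    HasDerivAt f (g r * ((f r) ^ 2 - a * (g r) ^ 2 + b)) r ∧
    HasDerivAt g (f r * (1 - (g r) ^ 2)) r

/-- `(f, g)` is a solution on `s` of the shifted regularized system
`f' + (2 φ(f,g)/(ρ+r)) f = g(f² − a g² + b)`, `g' = f(1 − g²)` with initial data `(fi, gi)`. -/
def IsShiftSolOn (a b : ℝ) (φ : ℝ → ℝ → ℝ) (ρ fi gi : ℝ) (f g : ℝ → ℝ) (s : Set ℝ) : Prop :=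
  f 0 = fi ∧ g 0 = gi ∧ ContinuousOn f s ∧ ContinuousOn g s ∧
  ∀ r ∈ s,
    HasDerivAt f (g r * ((f r) ^ 2 - a * (g r) ^ 2 + b) - 2 * φ (f r) (g r) / (ρ + r) * f r) r ∧
    HasDerivAt g (f r * (1 - (g r) ^ 2)) r

/-- The interval `[0, R)` with possibly infinite right endpoint. -/
def edom (R : EReal) : Set ℝ := {r : ℝ | 0 ≤ r ∧ (r : EReal) < R}

/-- `g` changes sign at `r₀` relative to the interval `s`. -/
def ChangesSignAt (g : ℝ → ℝ) (s : Set ℝ) (r₀ : ℝ) : Prop :=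
  g r₀ = 0 ∧ ∃ ε > 0, Icc (r₀ - ε) (r₀ + ε) ⊆ s ∧
    g (r₀ - ε) * g (r₀ + ε) < 0 ∧ ∀ r ∈ Ioo (0 : ℝ) ε, g (r₀ - r) * g (r₀ + r) ≤ 0

/-- `g` changes sign exactly `k` times on `s`. -/
def ChangesSignExactly (g : ℝ → ℝ) (s : Set ℝ) (k : ℕ) : Prop :=
  {r | ChangesSignAt g s r}.Finite ∧ {r | ChangesSignAt g s r}.ncard = k

/-- The set `A_k`, for the family of solutions `x ↦ (F x, G x)`. -/
def Aset (a b : ℝ) (F G : ℝ → ℝ → ℝ) (k : ℕ) : Set ℝ :=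
  {x | x ∈ Ioo (0 : ℝ) 1 ∧
    (∃ L, L < 0 ∧ Tendsto (fun r => Ham a b (F x r) (G x r)) atTop (nhds L)) ∧
    ChangesSignExactly (G x) (Ioi 0) k}

/-- The set `I_k`, for the family of solutions `x ↦ (F x, G x)`. -/
def Iset (a b : ℝ) (F G : ℝ → ℝ → ℝ) (k : ℕ) : Set ℝ :=
  {x | x ∈ Ioo (0 : ℝ) 1 ∧
    Tendsto (fun r => (F x r, G x r)) atTop (nhds ((0 : ℝ), (0 : ℝ))) ∧
    ChangesSignExactly (G x) (Ioi 0) k}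

/-- Grönwall comparison on a half-open interval: if `y' ≤ q y` with `q` continuous, then `y r` is
bounded above by a positive multiple of `y 0`. -/
lemma exists_pos_le_mul_of_deriv_le {R : ℝ} {y y' q : ℝ → ℝ}
    (hy : ContinuousOn y (Ico 0 R)) (hq : ContinuousOn q (Ico 0 R))
    (hd : ∀ r ∈ Ico 0 R, 0 < r → HasDerivAt y (y' r) r)
    (hle : ∀ r ∈ Ico 0 R, 0 < r → y' r ≤ q r * y r) {r : ℝ} (hr : r ∈ Ico 0 R) :
    ∃ c > 0, y r ≤ c * y 0 := by
  have hsub : Icc 0 r ⊆ Ico 0 R := fun s hs => ⟨hs.1, hs.2.trans_lt hr.2⟩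
  set Q : ℝ → ℝ := IccExtend hr.1 ((Icc 0 r).domRestrict q) with hQ
  have hQc : Continuous Q := (hq.mono hsub).domRestrict.Icc_extend'
  have hQe : ∀ s ∈ Icc 0 r, Q s = q s := fun s hs => by
    rw [hQ, IccExtend_of_mem _ _ hs]; rfl
  set μ : ℝ → ℝ := fun s => ∫ t in (0 : ℝ)..s, Q t with hμ
  have hμd : ∀ s, HasDerivAt μ (Q s) s := fun s => (hQc.integral_hasStrictDerivAt 0 s).hasDerivAt
  have hμc : Continuous μ := continuous_iff_continuousAt.2 fun s => (hμd s).continuousAt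
  have hzd : ∀ s ∈ Ioo 0 r, HasDerivAt (fun s => y s * exp (-μ s))
      (y' s * exp (-μ s) + y s * (exp (-μ s) * -Q s)) s := fun s hs =>
    (hd s (hsub (Ioo_subset_Icc_self hs)) hs.1).mul (hμd s).neg.exp
  have hanti : AntitoneOn (fun s => y s * exp (-μ s)) (Icc 0 r) := by
    apply antitoneOn_of_deriv_nonpos (convex_Icc 0 r)
    · exact (hy.mono hsub).mul (Real.continuous_exp.comp hμc.neg).continuousOn
    · rw [interior_Icc]
      exact fun s hs => (hzd s hs).differentiableAt.differentiableWithinAt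
    · rw [interior_Icc]
      intro s hs
      have hs' := Ioo_subset_Icc_self hs
      rw [(hzd s hs).deriv, hQe s hs']
      nlinarith [hle s (hsub hs') hs.1, exp_pos (-μ s)]
  have h := hanti (left_mem_Icc.2 hr.1) (right_mem_Icc.2 hr.1) hr.1
  have h0 : μ 0 = 0 := by simp [hμ]
  refine ⟨exp (μ r), exp_pos _, ?_⟩
  simp only [h0, neg_zero, exp_zero, mul_one, exp_neg] at h
  rw [← div_eq_mul_inv, div_le_iff₀ (exp_pos _)] at h
  linarith

/-- A priori bounds for solutions of the regularized system. -/
lemma IsRegSolOn.bounds {a b x R : ℝ} {φ : ℝ → ℝ → ℝ} {f g : ℝ → ℝ} (hb : 0 < b)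
    (hab : 2 * b < a) (hφ : ∀ f g, 0 ≤ φ f g) (hx : x ^ 2 ≤ 1)
    (h : IsRegSolOn a b φ x f g (Ico 0 R)) {r : ℝ} (hr : r ∈ Ico 0 R) :
    2 * f r ^ 2 - a * g r ^ 2 - (a - 2 * b) < 0 ∧ g r ^ 2 ≤ 1 ∧ (x ^ 2 < 1 → g r ^ 2 < 1) := by
  obtain ⟨hf0, hg0, hf, hg, hd⟩ := h
  obtain ⟨c, hc, hK⟩ := exists_pos_le_mul_of_deriv_le
    (y := fun r => 2 * f r ^ 2 - a * g r ^ 2 - (a - 2 * b)) (q := fun r => 2 * f r * g r)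
    (by fun_prop) (by fun_prop)
    (fun s hs h0 => (((((hd s hs h0).1).pow 2).const_mul 2).sub
      ((((hd s hs h0).2).pow 2).const_mul a)).sub_const _)
    (fun s hs h0 => by
      have h1 : 0 ≤ 8 * (φ (f s) (g s) / s * f s ^ 2) := by
        have := hφ (f s) (g s)
        positivity
      rw [← sub_nonneg]
      convert! h1 using 1
      push_cast
      ring) hr
  obtain ⟨d, hd0, hw⟩ := exists_pos_le_mul_of_deriv_le
    (y := fun r => g r ^ 2 - 1) (q := fun r => -2 * f r * g r)
    (by fun_prop) (by fun_prop)
    (fun s hs h0 => (((hd s hs h0).2).pow 2).sub_const 1)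
    (fun s hs h0 => le_of_eq (by push_cast; ring)) hr
  simp only [hf0, hg0] at hK hw
  refine ⟨?_, by nlinarith, fun hx' => by nlinarith⟩
  have : 2 * (0 : ℝ) ^ 2 - a * x ^ 2 - (a - 2 * b) < 0 := by nlinarith [sq_nonneg x]
  exact hK.trans_lt (mul_neg_of_pos_of_neg hc this)

/-- Global solvability of the rescaled integral equation
`u r = u₀ + r ∫₀¹ N(t, rt, u(rt)) dt` for a bounded and uniformly Lipschitz kernel `N`. -/
lemma exists_continuous_integral_eq {E : Type*} [NormedAddCommGroup E] [NormedSpace ℝ E]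
    [CompleteSpace E] {N : ℝ → ℝ → E → E}
    (hN : Continuous fun p : ℝ × ℝ × E => N p.1 p.2.1 p.2.2) {M : ℝ} {L : NNReal}
    (hM : ∀ t ∈ Icc (0 : ℝ) 1, ∀ s p, ‖N t s p‖ ≤ M)
    (hL : ∀ t ∈ Icc (0 : ℝ) 1, ∀ s, LipschitzWith L (N t s)) (u₀ : E) :
    ∃ u : ℝ → E, Continuous u ∧
      ∀ r, u r = u₀ + r • ∫ t in (0 : ℝ)..1, N t (r * t) (u (r * t)) := by
  set l : ℝ := L + 1 with hl
  have hl0 : 0 < l := by positivity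
  have hM0 : 0 ≤ M := (norm_nonneg _).trans (hM 0 (by simp) 0 0)
  have hexp : ∀ r : ℝ, |r| ≤ exp (l * |r|) := fun r => by
    have h1 := add_one_le_exp (l * |r|)
    have h2 : 0 ≤ (L : ℝ) * |r| := by positivity
    nlinarith
  set w : ℝ → ℝ := fun r => exp (l * |r|) with hw
  have hwpos : ∀ r, 0 < w r := fun r => exp_pos _
  have hw1 : ∀ r, 1 ≤ w r := fun r => one_le_exp (by positivity)
  have hwc : Continuous w := by fun_prop
  have hNv : ∀ v : ℝ → E, Continuous v →
      Continuous fun p : ℝ × ℝ => N p.2 (p.1 * p.2) (w (p.1 * p.2) • v (p.1 * p.2)) :=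
    fun v hv => hN.comp (f := fun p : ℝ × ℝ =>
      (p.2, p.1 * p.2, w (p.1 * p.2) • v (p.1 * p.2))) (by fun_prop)
  set I : (ℝ → E) → ℝ → E := fun v r =>
    ∫ t in (0 : ℝ)..1, N t (r * t) (w (r * t) • v (r * t)) with hI
  have hIc : ∀ v : ℝ → E, Continuous v → Continuous (I v) := fun v hv =>
    intervalIntegral.continuous_parametric_intervalIntegral_of_continuous' (hNv v hv) 0 1
  have hIM : ∀ (v : ℝ → E) r, ‖I v r‖ ≤ M := fun v r => by
    have := intervalIntegral.norm_integral_le_of_norm_le_const (a := 0) (b := 1) (C := M)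
      (f := fun t => N t (r * t) (w (r * t) • v (r * t))) (fun t ht => by
        rw [uIoc_of_le zero_le_one] at ht
        exact hM t (Ioc_subset_Icc_self ht) _ _)
    simpa using this
  have hΦb : ∀ (v : ℝ → E) r, ‖(w r)⁻¹ • (u₀ + r • I v r)‖ ≤ ‖u₀‖ + M := fun v r => by
    rw [norm_smul, norm_inv, norm_of_nonneg (hwpos r).le, inv_mul_le_iff₀ (hwpos r)]
    refine (norm_add_le _ _).trans ?_
    rw [norm_smul, mul_add, Real.norm_eq_abs]
    gcongr
    · exact le_mul_of_one_le_left (norm_nonneg _) (hw1 r)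
    · exact hexp r
    · exact hIM v r
  have hΦc : ∀ v : ℝ → E, Continuous v →
      Continuous fun r => (w r)⁻¹ • (u₀ + r • I v r) := fun v hv =>
    (hwc.inv₀ fun r => (hwpos r).ne').smul
      (continuous_const.add (continuous_id.smul (hIc v hv)))
  set Φ : BoundedContinuousFunction ℝ E → BoundedContinuousFunction ℝ E := fun v =>
    BoundedContinuousFunction.ofNormedAddCommGroup (fun r => (w r)⁻¹ • (u₀ + r • I v r))
      (hΦc v v.continuous) (‖u₀‖ + M) (hΦb v)
  have hint : ∀ r : ℝ, |r| * ∫ t in (0 : ℝ)..1, w (r * t) = (w r - 1) / l := fun r => by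
    have h1 : ∀ t ∈ uIcc (0 : ℝ) 1, HasDerivAt (fun t => exp (l * |r| * t) / l)
        (|r| * w (r * t)) t := fun t ht => by
      rw [uIcc_of_le zero_le_one] at ht
      have := ((((hasDerivAt_id t).const_mul (l * |r|)).exp).div_const l)
      convert! this using 1
      simp only [hw, abs_mul, abs_of_nonneg ht.1, id]
      field_simp
    rw [← intervalIntegral.integral_const_mul, intervalIntegral.integral_eq_sub_of_hasDerivAt h1
      (Continuous.intervalIntegrable (by fun_prop) _ _)]
    simp [hw]
    ring
  have hcontr : ContractingWith (L / (L + 1)) Φ := by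
    refine ⟨?_, LipschitzWith.of_dist_le_mul fun v v' => ?_⟩
    · rw [div_lt_one (by positivity)]; exact lt_add_one L
    · refine (BoundedContinuousFunction.dist_le (by positivity)).2 fun r => ?_
      have hdiff : ‖I v r - I v' r‖ ≤ (∫ t in (0 : ℝ)..1, w (r * t)) * (L * dist v v') := by
        rw [hI, ← intervalIntegral.integral_sub, ← intervalIntegral.integral_mul_const]
        · refine intervalIntegral.norm_integral_le_of_norm_le zero_le_one
            (Eventually.of_forall fun t ht => ?_)
            (Continuous.intervalIntegrable (by fun_prop) _ _)
          rw [← dist_eq_norm]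
          refine ((hL t (Ioc_subset_Icc_self ht) _).dist_le_mul _ _).trans ?_
          rw [dist_smul₀, norm_of_nonneg (hwpos _).le]
          have := BoundedContinuousFunction.dist_coe_le_dist (f := v) (g := v') (r * t)
          calc (L : ℝ) * (w (r * t) * dist (v (r * t)) (v' (r * t)))
              ≤ L * (w (r * t) * dist v v') := by
                have := (hwpos (r * t)).le
                gcongr
            _ = _ := by ring
        · exact ((hNv v v.continuous).comp (Continuous.prodMk_right r)).intervalIntegrable _ _
        · exact ((hNv v' v'.continuous).comp (Continuous.prodMk_right r)).intervalIntegrable _ _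
      change dist ((w r)⁻¹ • (u₀ + r • I v r)) ((w r)⁻¹ • (u₀ + r • I v' r)) ≤ _
      rw [dist_smul₀, dist_add_left, dist_smul₀, dist_eq_norm, norm_inv,
        norm_of_nonneg (hwpos r).le, inv_mul_le_iff₀ (hwpos r), Real.norm_eq_abs]
      calc |r| * ‖I v r - I v' r‖
          ≤ |r| * ((∫ t in (0 : ℝ)..1, w (r * t)) * (L * dist v v')) := by gcongr
        _ = (w r - 1) / l * (L * dist v v') := by rw [← hint r]; ring
        _ ≤ w r / l * (L * dist v v') := by gcongr; linarith
        _ = _ := by rw [hl]; push_cast; ring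
  set v := ContractingWith.fixedPoint Φ hcontr
  have hfix : Φ v = v := hcontr.fixedPoint_isFixedPt
  have hvr : ∀ r, w r • v r = u₀ + r • I v r := fun r => by
    conv_lhs => rw [← hfix]
    exact smul_inv_smul₀ (hwpos r).ne' _
  exact ⟨fun r => w r • v r, hwc.smul v.continuous, hvr⟩

/-- Global solvability of `F' + (2/r) F = A(r, F, G)`, `G' = B(F, G)`, `F(0) = 0`, `G(0) = x` for
bounded and uniformly Lipschitz `A` and `B`. -/
lemma exists_singular_system {A : ℝ → ℝ × ℝ → ℝ} {B : ℝ × ℝ → ℝ}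
    (hA : Continuous fun p : ℝ × ℝ × ℝ => A p.1 p.2) {M M' : ℝ} {L L' : NNReal}
    (hAM : ∀ s p, |A s p| ≤ M) (hAL : ∀ s, LipschitzWith L (A s))
    (hBM : ∀ p, |B p| ≤ M') (hBL : LipschitzWith L' B) (x : ℝ) :
    ∃ F G : ℝ → ℝ, Continuous F ∧ Continuous G ∧ G 0 = x ∧
      (∀ r, F r = r * ∫ t in (0 : ℝ)..1, t ^ 2 * A (r * t) (F (r * t), G (r * t))) ∧
      ∀ r > 0, HasDerivAt F (A r (F r, G r) - 2 / r * F r) r ∧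
        HasDerivAt G (B (F r, G r)) r := by
  have hBc := hBL.continuous
  have hsq : ∀ t ∈ Icc (0 : ℝ) 1, |t ^ 2| ≤ 1 := fun t ht => by
    rw [abs_of_nonneg (sq_nonneg t)]
    exact pow_le_one₀ ht.1 ht.2
  obtain ⟨u, huc, hu⟩ := exists_continuous_integral_eq
    (N := fun t s p => (t ^ 2 * A s p, B p)) (M := max M M') (L := max L L')
    ((by fun_prop : Continuous fun p : ℝ × ℝ × ℝ × ℝ => p.1 ^ 2).mul
      (hA.comp continuous_snd) |>.prodMk (hBc.comp (by fun_prop)))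
    (fun t ht s p => by
      refine max_le_max ?_ (hBM p)
      rw [norm_mul, Real.norm_eq_abs, Real.norm_eq_abs]
      exact (mul_le_of_le_one_left (abs_nonneg _) (hsq t ht)).trans (hAM s p))
    (fun t ht s => LipschitzWith.prodMk (LipschitzWith.of_dist_le_mul fun p q => by
      rw [Real.dist_eq, ← mul_sub, abs_mul, ← Real.dist_eq]
      exact (mul_le_of_le_one_left dist_nonneg (hsq t ht)).trans ((hAL s).dist_le_mul p q)) hBL)
    ((0 : ℝ), x)
  have hF : Continuous fun r => (u r).1 := huc.fst
  have hG : Continuous fun r => (u r).2 := huc.snd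
  have hAu : Continuous fun r => A r (u r) :=
    hA.comp (f := fun r => (r, u r)) (continuous_id.prodMk huc)
  have hBu : Continuous fun r => B (u r) := hBc.comp huc
  have hii : ∀ r : ℝ, IntervalIntegrable
      (fun t => (t ^ 2 * A (r * t) (u (r * t)), B (u (r * t)))) MeasureTheory.volume 0 1 :=
    fun r => Continuous.intervalIntegrable
      (((continuous_pow 2).mul (hAu.comp (continuous_const_mul r))).prodMk
        (hBu.comp (continuous_const_mul r))) _ _
  have h1 : ∀ r, (u r).1 = r * ∫ t in (0 : ℝ)..1, t ^ 2 * A (r * t) (u (r * t)) := fun r => by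
    have := (ContinuousLinearMap.fst ℝ ℝ ℝ).intervalIntegral_comp_comm (hii r)
    simp only [ContinuousLinearMap.coe_fst'] at this
    rw [this]
    conv_lhs => rw [hu r]
    simp
  have h2 : ∀ r, (u r).2 = x + ∫ s in (0 : ℝ)..r, B (u s) := fun r => by
    have h := intervalIntegral.smul_integral_comp_mul_left (a := 0) (b := 1)
      (f := fun s => B (u s)) r
    rw [mul_zero, mul_one] at h
    have := (ContinuousLinearMap.snd ℝ ℝ ℝ).intervalIntegral_comp_comm (hii r)
    simp only [ContinuousLinearMap.coe_snd'] at this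
    rw [← h, this]
    conv_lhs => rw [hu r]
    simp
  have h3 : ∀ r ≠ 0, (u r).1 = (r ^ 2)⁻¹ * ∫ s in (0 : ℝ)..r, s ^ 2 * A s (u s) := fun r hr => by
    have h := intervalIntegral.smul_integral_comp_mul_left (a := 0) (b := 1)
      (f := fun s => s ^ 2 * A s (u s)) r
    rw [mul_zero, mul_one] at h
    rw [h1, ← h]
    simp only [mul_pow, mul_assoc, intervalIntegral.integral_const_mul, smul_eq_mul]
    field_simp
  refine ⟨fun r => (u r).1, fun r => (u r).2, hF, hG, by simp [h2], h1, fun r hr => ⟨?_, ?_⟩⟩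
  · have hc : Continuous fun s => s ^ 2 * A s (u s) := (continuous_pow 2).mul hAu
    have hI := (hc.integral_hasStrictDerivAt 0 r).hasDerivAt
    have hd := ((hasDerivAt_pow 2 r).inv (by positivity)).mul hI
    refine (hd.congr_of_eventuallyEq ((eventually_ne_nhds hr.ne').mono h3)).congr_deriv ?_
    change _ = A r (u r) - 2 / r * (u r).1
    rw [h3 r hr.ne']
    simp only [Pi.inv_apply]
    field_simp
    ring
  · have hI := (hBu.integral_hasStrictDerivAt 0 r).hasDerivAt.const_add x
    exact hI.congr_of_eventuallyEq (Eventually.of_forall h2)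

/-- Projection of the plane onto the square `[-D, D]²`. -/
def clampSquare (D : ℝ) (p : ℝ × ℝ) : ℝ × ℝ := (max (-D) (min p.1 D), max (-D) (min p.2 D))

lemma lipschitzWith_clampSquare (D : ℝ) : LipschitzWith 1 (clampSquare D) := by
  have h := LipschitzWith.prodMk (((LipschitzWith.prod_fst (α := ℝ) (β := ℝ)).min_const D).const_max
    (-D)) (((LipschitzWith.prod_snd (α := ℝ) (β := ℝ)).min_const D).const_max (-D))
  rwa [max_self] at h

lemma clampSquare_mem {D : ℝ} (hD : 0 ≤ D) (p : ℝ × ℝ) :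
    clampSquare D p ∈ Icc (-D) D ×ˢ Icc (-D) D :=
  ⟨⟨le_max_left _ _, max_le (by linarith) (min_le_right _ _)⟩,
    ⟨le_max_left _ _, max_le (by linarith) (min_le_right _ _)⟩⟩

lemma clampSquare_eq_self {D : ℝ} {p : ℝ × ℝ} (h1 : |p.1| ≤ D) (h2 : |p.2| ≤ D) :
    clampSquare D p = p := by
  rw [abs_le] at h1 h2
  simp [clampSquare, h1, h2]

lemma exists_lipschitzWith_comp_clampSquare {h : ℝ × ℝ → ℝ} (hh : ContDiff ℝ 1 h) {D : ℝ}
    (hD : 0 ≤ D) :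
    ∃ (K : NNReal) (M : ℝ), LipschitzWith K (fun p => h (clampSquare D p)) ∧
      ∀ p, |h (clampSquare D p)| ≤ M := by
  have hc : IsCompact (Icc (-D) D ×ˢ Icc (-D) D) := isCompact_Icc.prod isCompact_Icc
  obtain ⟨K, hK⟩ := (hh.locallyLipschitz.locallyLipschitzOn (s := Icc (-D) D ×ˢ Icc (-D) D)
    ).exists_lipschitzOnWith_of_compact hc
  obtain ⟨M, hM⟩ := hc.exists_bound_of_continuousOn hh.continuous.continuousOn
  refine ⟨K, M, LipschitzWith.of_dist_le_mul fun p q => ?_, fun p => hM _ (clampSquare_mem hD p)⟩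
  refine (hK.dist_le_mul _ (clampSquare_mem hD p) _ (clampSquare_mem hD q)).trans ?_
  gcongr
  simpa using (lipschitzWith_clampSquare D).dist_le_mul p q

lemma IsCutoff.contDiff_one_sub_mul {a b η : ℝ} {φ : ℝ → ℝ → ℝ} (hη : 0 < η)
    (hφ : IsCutoff a b η φ) : ContDiff ℝ 1 fun p : ℝ × ℝ => 2 * (1 - φ p.1 p.2) * p.1 := by
  obtain ⟨-, hsm, -, h0, -⟩ := hφ
  have key : ContDiff ℝ 1 fun p : ℝ × ℝ => φ p.1 p.2 := by
    rw [contDiff_iff_contDiffAt]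
    intro p
    by_cases hp : |p.1| < √(a - b)
    · exact (hsm.contDiffAt ((isOpen_Ioo.prod isOpen_univ).mem_nhds
        ⟨abs_lt.1 hp, mem_univ _⟩)).of_le (by exact_mod_cast le_top)
    · have hev : ∀ᶠ q : ℝ × ℝ in 𝓝 p, √(a - b) - η / 2 < |q.1| :=
        (continuous_fst.abs).continuousAt.eventually_const_lt (by
          simp only [not_lt] at hp
          linarith)
      exact (contDiffAt_const (c := (0 : ℝ))).congr_of_eventuallyEq
        (hev.mono fun q hq => h0 _ _ hq.le)
  fun_prop

lemma IsRegSolOn.mono {a b x : ℝ} {φ : ℝ → ℝ → ℝ} {f g : ℝ → ℝ} {s t : Set ℝ}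
    (h : IsRegSolOn a b φ x f g t) (hst : s ⊆ t) : IsRegSolOn a b φ x f g s :=
  ⟨h.1, h.2.1, h.2.2.1.mono hst, h.2.2.2.1.mono hst, fun r hr => h.2.2.2.2 r (hst hr)⟩

lemma mem_interior_Aadm {a b f g : ℝ} (hf : 2 * f ^ 2 - a * g ^ 2 - (a - 2 * b) < 0)
    (hg : g ^ 2 < 1) : (f, g) ∈ interior (Aadm a b) := by
  have hopen : IsOpen {p : ℝ × ℝ | 2 * p.1 ^ 2 - a * p.2 ^ 2 - (a - 2 * b) < 0 ∧ p.2 ^ 2 < 1} :=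
    (isOpen_lt (f := fun p : ℝ × ℝ => 2 * p.1 ^ 2 - a * p.2 ^ 2 - (a - 2 * b)) (by fun_prop)
      continuous_const).and
    (isOpen_lt (f := fun p : ℝ × ℝ => p.2 ^ 2) (by fun_prop) continuous_const)
  refine interior_maximal (fun p hp => ?_) hopen ⟨hf, hg⟩
  exact ⟨hp.1.le, hp.2.le⟩

/-- The regularized Cauchy problem with `x ^ 2 ≤ 1` has a solution on `[0, ∞)`. -/
lemma IsCutoff.exists_isRegSolOn {a b η x : ℝ} {φ : ℝ → ℝ → ℝ} (hφ : IsCutoff a b η φ)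
    (hb : 0 < b) (hab : 2 * b < a) (hη : η ∈ Ioo 0 (√(a - b) - √(a / 2))) (hx : x ^ 2 ≤ 1) :
    ∃ F G : ℝ → ℝ, IsRegSolOn a b φ x F G (Ici 0) := by
  set C := √(a - b)
  set D := C + 2 with hD
  set c := C - η with hc
  have hC0 : 0 ≤ C := Real.sqrt_nonneg _
  have hCsq : C ^ 2 = a - b := Real.sq_sqrt (by linarith)
  have hc0 : 0 < c := by linarith [hη.2, Real.sqrt_nonneg (a / 2)]
  have hD0 : 0 ≤ D := by linarith
  set Pf : ℝ × ℝ → ℝ := fun p => p.2 * (p.1 ^ 2 - a * p.2 ^ 2 + b) with hPf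
  set Ψ : ℝ × ℝ → ℝ := fun p => 2 * (1 - φ p.1 p.2) * p.1 with hΨ
  set Qf : ℝ × ℝ → ℝ := fun p => p.1 * (1 - p.2 ^ 2) with hQf
  obtain ⟨K₁, M₁, hL₁, hM₁⟩ := exists_lipschitzWith_comp_clampSquare
    (h := Pf) (by fun_prop) hD0
  obtain ⟨K₂, M₂, hL₂, hM₂⟩ := exists_lipschitzWith_comp_clampSquare
    (hφ.contDiff_one_sub_mul hη.1) hD0
  obtain ⟨K₃, M₃, hL₃, hM₃⟩ := exists_lipschitzWith_comp_clampSquare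
    (h := Qf) (by fun_prop) hD0
  have hM₁0 : 0 ≤ M₁ := (abs_nonneg _).trans (hM₁ 0)
  obtain ⟨δ, hδ⟩ : ∃ δ : NNReal, (δ : ℝ) = c / (2 * (M₁ + 1)) :=
    ⟨_, Real.coe_toNNReal _ (by positivity)⟩
  have hδ0 : 0 < (δ : ℝ) := by rw [hδ]; positivity
  have hδM : δ * M₁ ≤ c / 2 := by
    rw [hδ, div_mul_eq_mul_div, div_le_div_iff₀ (by positivity) (by positivity)]
    nlinarith
  have hmaxpos : ∀ s, 0 < max s (δ : ℝ) := fun s => lt_max_of_lt_right hδ0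
  have hmaxle : ∀ s, (max s (δ : ℝ))⁻¹ ≤ (δ : ℝ)⁻¹ := fun s =>
    inv_anti₀ hδ0 (le_max_right _ _)
  obtain ⟨F, G, hFc, hGc, hG0, hFint, hder⟩ := exists_singular_system
    (A := fun s p => Pf (clampSquare D p) + (max s (δ : ℝ))⁻¹ * Ψ (clampSquare D p))
    (B := fun p => Qf (clampSquare D p)) (M := M₁ + (δ : ℝ)⁻¹ * M₂) (L := K₁ + δ⁻¹ * K₂)
    ((hL₁.continuous.comp continuous_snd).add
      (((continuous_fst.max continuous_const).inv₀ fun p => (hmaxpos _).ne').mul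
        (hL₂.continuous.comp continuous_snd)))
    (fun s p => by
      refine (abs_add_le _ _).trans (add_le_add (hM₁ p) ?_)
      rw [abs_mul, abs_of_pos (inv_pos.2 (hmaxpos s))]
      exact mul_le_mul (hmaxle s) (hM₂ p) (abs_nonneg _) (by positivity))
    (fun s => hL₁.add (LipschitzWith.of_dist_le_mul fun p q => by
      rw [Real.dist_eq, ← mul_sub, abs_mul, abs_of_pos (inv_pos.2 (hmaxpos s)), ← Real.dist_eq]
      push_cast
      rw [mul_assoc]
      exact mul_le_mul (hmaxle s) (hL₂.dist_le_mul p q) dist_nonneg (by positivity)))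
    hM₃ hL₃ x
  have hF0 : F 0 = 0 := by rw [hFint]; simp
  set bad : Set ℝ := {r | 0 ≤ r ∧ (D ≤ |F r| ∨ D ≤ |G r| ∨ r ≤ δ ∧ c ≤ |F r|)} with hbad
  have hsol : ∀ s : Set ℝ, s ⊆ Ici 0 → Disjoint s bad → IsRegSolOn a b φ x F G s := by
    refine fun s hs hsb => ⟨hF0, hG0, hFc.continuousOn, hGc.continuousOn, fun r hr hr0 => ?_⟩
    have hnb : r ∉ bad := fun h => Set.disjoint_left.1 hsb hr h
    simp only [hbad, mem_ofPred_eq, not_and, not_or, not_le] at hnb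
    obtain ⟨h1, h2, h3⟩ := hnb hr0.le
    obtain ⟨hdF, hdG⟩ := hder r hr0
    rw [clampSquare_eq_self h1.le h2.le] at hdF hdG
    refine ⟨hdF.congr_deriv ?_, hdG⟩
    simp only [hPf, hΨ]
    rcases le_or_gt r δ with hrδ | hrδ
    · rw [hφ.2.2.2.2 _ _ (h3 hrδ).le]
      ring
    · rw [max_eq_left hrδ.le]
      ring
  have hempty : bad = ∅ := by
    by_contra hne
    have hclosed : IsClosed bad :=
      isClosed_Ici.inter ((isClosed_le continuous_const hFc.abs).union
        ((isClosed_le continuous_const hGc.abs).union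
          (isClosed_Iic.inter (isClosed_le continuous_const hFc.abs))))
    have hbdd : BddBelow bad := ⟨0, fun r hr => hr.1⟩
    set R := sInf bad
    have hRmem : R ∈ bad := hclosed.csInf_mem (nonempty_iff_ne_empty.2 hne) hbdd
    have hlt : ∀ r ∈ Ico 0 R, r ∉ bad := fun r hr h => (csInf_le hbdd h).not_gt hr.2
    have hRsol := hsol (Ico 0 R) (fun r hr => hr.1) (Set.disjoint_left.2 hlt)
    have hR0 : 0 < R := by
      refine lt_of_le_of_ne hRmem.1 fun h0 => ?_
      have h := hRmem.2
      have hx1 : |x| ≤ 1 := abs_le_one_iff_mul_self_le_one.2 (by nlinarith)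
      rw [← h0, hF0, hG0, abs_zero] at h
      rcases h with h | h | ⟨-, h⟩ <;> linarith
    have hclo : R ∈ closure (Ico 0 R) := by
      rw [closure_Ico hR0.ne]
      exact right_mem_Icc.2 hR0.le
    have hb1 : ∀ r ∈ Ico 0 R, |F r| ≤ C ∧ |G r| ≤ 1 := fun r hr => by
      obtain ⟨hK, hg, -⟩ := hRsol.bounds hb hab (fun f g => (hφ.1 f g).1) hx hr
      exact ⟨abs_le_of_sq_le_sq (by nlinarith) hC0, abs_le_of_sq_le_sq (by linarith) zero_le_one⟩
    have hFR : |F R| ≤ C :=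
      closure_minimal (fun r hr => (hb1 r hr).1) (isClosed_le hFc.abs continuous_const) hclo
    have hGR : |G R| ≤ 1 :=
      closure_minimal (fun r hr => (hb1 r hr).2) (isClosed_le hGc.abs continuous_const) hclo
    rcases hRmem.2 with h | h | ⟨hRδ, h⟩
    · linarith
    · linarith
    · have hb2 : ∀ r ∈ Ico 0 R, |F r| ≤ c / 2 := fun r hr => by
        have hI := intervalIntegral.norm_integral_le_of_norm_le_const (a := 0) (b := 1) (C := M₁)
          (f := fun t => t ^ 2 * (Pf (clampSquare D (F (r * t), G (r * t))) +
            (max (r * t) (δ : ℝ))⁻¹ * Ψ (clampSquare D (F (r * t), G (r * t)))))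
          (fun t ht => by
            rw [uIoc_of_le zero_le_one] at ht
            have hrt : r * t ∈ Ico 0 R := ⟨mul_nonneg hr.1 ht.1.le,
              (mul_le_of_le_one_right hr.1 ht.2).trans_lt hr.2⟩
            have hnb := hlt _ hrt
            simp only [hbad, mem_ofPred_eq, not_and, not_or, not_le] at hnb
            obtain ⟨h1, h2, h3⟩ := hnb hrt.1
            have hΨ0 : Ψ (clampSquare D (F (r * t), G (r * t))) = 0 := by
              rw [clampSquare_eq_self h1.le h2.le]
              simp [hΨ, hφ.2.2.2.2 _ _ (h3 (hrt.2.le.trans hRδ)).le]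
            rw [hΨ0, mul_zero, add_zero, norm_mul, norm_pow, Real.norm_eq_abs, abs_of_pos ht.1]
            exact (mul_le_of_le_one_left (norm_nonneg _) (pow_le_one₀ ht.1.le ht.2)).trans
              (hM₁ _))
        rw [hFint r, abs_mul, abs_of_nonneg hr.1, ← Real.norm_eq_abs]
        rw [sub_zero, abs_one, mul_one] at hI
        exact (mul_le_mul (hr.2.le.trans hRδ) hI (norm_nonneg _) hδ0.le).trans hδM
      have : |F R| ≤ c / 2 :=
        closure_minimal hb2 (isClosed_le hFc.abs continuous_const) hclo
      linarith
  exact ⟨F, G, hsol _ Subset.rfl (by rw [hempty]; exact Set.disjoint_empty _)⟩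

/-- Lemma 2.3: for `x² ≤ 1` the solution of the regularized system
satisfies `g² ≤ 1`, `f² ≤ a − b`, stays in `𝒜`, is global, and stays in the interior
of `𝒜` if `x² < 1`. -/
theorem solutions_global_and_admissible (a b η : ℝ) (hb : 0 < b) (hab : 2 * b < a)
    (hη : η ∈ Ioo 0 (Real.sqrt (a - b) - Real.sqrt (a / 2)))
    (φ : ℝ → ℝ → ℝ) (hφ : IsCutoff a b η φ) (x : ℝ) (hx : x ^ 2 ≤ 1) :
    (∀ R > 0, ∀ f g : ℝ → ℝ, IsRegSolOn a b φ x f g (Ico 0 R) →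
      ∀ r ∈ Ico 0 R, (g r) ^ 2 ≤ 1 ∧ (f r) ^ 2 ≤ a - b ∧ (f r, g r) ∈ Aadm a b ∧
        (x ^ 2 < 1 → (f r, g r) ∈ interior (Aadm a b))) ∧
    ∃ F G : ℝ → ℝ, IsRegSolOn a b φ x F G (Ici 0) ∧
      (∀ r ≥ 0, (F r, G r) ∈ Aadm a b) ∧
      (x ^ 2 < 1 → ∀ r ≥ 0, (F r, G r) ∈ interior (Aadm a b)) := by
  have hφ0 : ∀ f g, 0 ≤ φ f g := fun f g => (hφ.1 f g).1
  have main : ∀ {R : ℝ} {f g : ℝ → ℝ}, IsRegSolOn a b φ x f g (Ico 0 R) → ∀ r ∈ Ico 0 R,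
      (g r) ^ 2 ≤ 1 ∧ (f r) ^ 2 ≤ a - b ∧ (f r, g r) ∈ Aadm a b ∧
        (x ^ 2 < 1 → (f r, g r) ∈ interior (Aadm a b)) := fun h r hr => by
    obtain ⟨hK, hg, hg'⟩ := h.bounds hb hab hφ0 hx hr
    exact ⟨hg, by nlinarith, ⟨hK.le, hg⟩, fun hx' => mem_interior_Aadm hK (hg' hx')⟩
  obtain ⟨F, G, hFG⟩ := hφ.exists_isRegSolOn hb hab hη hx
  have hmem : ∀ r ≥ 0, (F r, G r) ∈ Aadm a b ∧
      (x ^ 2 < 1 → (F r, G r) ∈ interior (Aadm a b)) := fun r hr =>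
    (main (hFG.mono (Ico_subset_Ici_self (a := r + 1))) r ⟨hr, lt_add_one r⟩).2.2
  exact ⟨fun R _ f g h => main h, F, G, hFG, fun r hr => (hmem r hr).1,
    fun hx' r hr => (hmem r hr).2 hx'⟩
end
end

section
/- Let a, b > 0 with a − 2b > 0, η ∈ (0, √(a−b) − √(a/2)), φ_η an admissible cutoff, and x ∈ (0,1). Let (f_{x,η}, g_{x,η}) be the solution of the regularized system with f_{x,η}(0) = 0, g_{x,η}(0) = x. If g_{x,η} changes sign only a finite number of times on (0,∞) and lim_{r→+∞} H(f_{x,η}, g_{x,η})(r) ≥ 0, then there exists a constant C > 0 such that |f_{x,η}(r)| + |g_{x,η}(r)| ≤ C exp(−K_{a,b} r) for all r ≥ 0, where K_{a,b} = min{b/2, (2a − b)/(2a)}; in particular (f_{x,η}, g_{x,η})(r) → (0,0) as r → +∞. -/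
open Real Set Filter Topology

noncomputable section

/-- A scalar function with derivative `c * u` on `(0, ∞)` keeps the sign of `u 0 > 0`. -/
theorem pos_of_hasDerivAt_mul {u c : ℝ → ℝ} (hu : ContinuousOn u (Ici 0))
    (hc : ContinuousOn c (Ici 0)) (hd : ∀ r > 0, HasDerivAt u (c r * u r) r) (h0 : 0 < u 0) :
    ∀ r ≥ 0, 0 < u r := by
  have hcc : Continuous fun r => c (max r 0) :=
    hc.comp_continuous (by fun_prop) fun r => le_max_right r 0
  set P : ℝ → ℝ := fun r => ∫ t in (0 : ℝ)..r, c (max t 0) with hP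
  have hPd : ∀ r, HasDerivAt P (c (max r 0)) r := fun r =>
    (hcc.integral_hasStrictDerivAt 0 r).hasDerivAt
  have hPc : Continuous P := continuous_iff_continuousAt.2 fun r => (hPd r).continuousAt
  have hvd : ∀ r > 0, HasDerivAt (fun r => u r * exp (-P r)) 0 r := by
    intro r hr
    have h := (hd r hr).mul (hPd r).neg.exp
    rw [max_eq_left hr.le] at h
    refine h.congr_deriv ?_
    ring
  have hmono : MonotoneOn (fun r => u r * exp (-P r)) (Ici 0) := by
    apply monotoneOn_of_hasDerivWithinAt_nonneg (f' := fun _ => 0) (convex_Ici 0)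
    · exact hu.mul (by fun_prop)
    · intro r hr
      rw [interior_Ici] at hr
      exact (hvd r hr).hasDerivWithinAt
    · intro r hr
      exact le_rfl
  intro r hr
  have h1 : u 0 * exp (-P 0) ≤ u r * exp (-P r) := hmono self_mem_Ici hr hr
  have h2 : 0 < u 0 * exp (-P 0) := mul_pos h0 (exp_pos _)
  exact pos_of_mul_pos_left (h2.trans_le h1) (exp_pos _).le

/-- A function on a half-line whose derivative is at least `c > 0` is not bounded above. -/
theorem not_bddAbove_of_le_deriv {u u' : ℝ → ℝ} {R c B : ℝ} (hc : 0 < c)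
    (hd : ∀ r ≥ R, HasDerivAt u (u' r) r) (hu' : ∀ r ≥ R, c ≤ u' r) (hB : ∀ r ≥ R, u r ≤ B) :
    False := by
  have hmono : MonotoneOn (fun r => u r - c * r) (Ici R) := by
    apply monotoneOn_of_hasDerivWithinAt_nonneg (f' := fun r => u' r - c) (convex_Ici R)
    · intro r hr
      exact ((hd r hr).continuousAt.sub (by fun_prop)).continuousWithinAt
    · intro r hr
      rw [interior_Ici] at hr
      have h := (hd r (le_of_lt hr)).sub ((hasDerivAt_id r).const_mul c)
      exact (h.congr_deriv (by simp)).hasDerivWithinAt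
    · intro r hr
      rw [interior_Ici] at hr
      exact sub_nonneg.2 (hu' r (le_of_lt hr))
  have hBR : 0 ≤ B - u R := sub_nonneg.2 (hB R le_rfl)
  set s := R + (B - u R + 1) / c with hs
  have hsR : R ≤ s := by
    have : 0 ≤ (B - u R + 1) / c := by positivity
    linarith
  have h1 : u R - c * R ≤ u s - c * s := hmono self_mem_Ici hsR hsR
  have h2 : c * s = c * R + (B - u R + 1) := by
    rw [hs]
    field_simp
  linarith [hB s hsR]

/-- A function on a half-line with `u' ≤ -k u` decays at least like `exp (-k r)`. -/
theorem le_exp_of_deriv_le {u u' : ℝ → ℝ} {R k : ℝ}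
    (hd : ∀ r ≥ R, HasDerivAt u (u' r) r) (hu' : ∀ r ≥ R, u' r ≤ -k * u r) :
    ∀ r ≥ R, u r ≤ u R * exp (k * R) * exp (-k * r) := by
  have hder : ∀ r ≥ R, HasDerivAt (fun r => u r * exp (k * r))
      (u' r * exp (k * r) + u r * (exp (k * r) * k)) r := by
    intro r hr
    have h := (hd r hr).mul ((hasDerivAt_id r).const_mul k).exp
    exact h.congr_deriv (by simp)
  have hanti : AntitoneOn (fun r => u r * exp (k * r)) (Ici R) := by
    apply antitoneOn_of_hasDerivWithinAt_nonpos
      (f' := fun r => u' r * exp (k * r) + u r * (exp (k * r) * k)) (convex_Ici R)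
    · intro r hr
      exact (hder r hr).continuousAt.continuousWithinAt
    · intro r hr
      rw [interior_Ici] at hr
      exact (hder r (le_of_lt hr)).hasDerivWithinAt
    · intro r hr
      rw [interior_Ici] at hr
      have h := mul_nonneg (sub_nonneg.2 (hu' r (le_of_lt hr))) (exp_pos (k * r)).le
      linarith
  intro r hr
  have h : u r * exp (k * r) ≤ u R * exp (k * R) := hanti self_mem_Ici hr hr
  have h2 : exp (k * r) * exp (-k * r) = 1 := by
    rw [← exp_add]
    simp
  calc u r = u r * exp (k * r) * exp (-k * r) := by rw [mul_assoc, h2, mul_one]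
    _ ≤ _ := mul_le_mul_of_nonneg_right h (exp_pos _).le

/-- If `u` has negative derivative wherever it takes the value `c`, it stays below `c`. -/
theorem le_const_of_deriv_neg {u u' : ℝ → ℝ} {R c : ℝ}
    (hd : ∀ r ≥ R, HasDerivAt u (u' r) r) (h0 : u R ≤ c)
    (hu' : ∀ r ≥ R, u r = c → u' r < 0) : ∀ r ≥ R, u r ≤ c := by
  intro r hr
  exact image_le_of_deriv_right_lt_deriv_boundary (f := u) (f' := u') (a := R) (b := r)
    (B := fun _ => c) (B' := fun _ => 0)
    (fun s hs => (hd s hs.1).continuousAt.continuousWithinAt)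
    (fun s hs => (hd s hs.1).hasDerivWithinAt) h0 (fun s => hasDerivAt_const s c)
    (fun s hs h => hu' s hs.1 h) (right_mem_Icc.2 hr)

/-- A bounded solution of nonnegative energy on `[R, ∞)` whose second component is positive. The
function `ψ` is the value of the cutoff along the solution. -/
structure IsPosTail (a b q R : ℝ) (ψ f g : ℝ → ℝ) : Prop where
  b_pos : 0 < b
  b_lt : 2 * b < a
  q_lt : q < 1
  R_pos : 0 < R
  cutoff_mem : ∀ r ≥ R, ψ r ∈ Icc (0 : ℝ) 1
  deriv_f : ∀ r ≥ R,
    HasDerivAt f (g r * ((f r) ^ 2 - a * (g r) ^ 2 + b) - 2 * ψ r / r * f r) r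
  deriv_g : ∀ r ≥ R, HasDerivAt g (f r * (1 - (g r) ^ 2)) r
  g_pos : ∀ r ≥ R, 0 < g r
  g_sq_le : ∀ r ≥ R, g r ^ 2 ≤ q
  f_sq_le : ∀ r ≥ R, f r ^ 2 ≤ a
  energy : ∀ r ≥ R, g r ^ 2 * (b - a / 2 * g r ^ 2) ≤ f r ^ 2 * (1 - g r ^ 2)

namespace IsPosTail

variable {a b q R : ℝ} {ψ f g : ℝ → ℝ}

theorem mono (h : IsPosTail a b q R ψ f g) {S : ℝ} (hS : R ≤ S) : IsPosTail a b q S ψ f g where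
  b_pos := h.b_pos
  b_lt := h.b_lt
  q_lt := h.q_lt
  R_pos := h.R_pos.trans_le hS
  cutoff_mem r hr := h.cutoff_mem r (hS.trans hr)
  deriv_f r hr := h.deriv_f r (hS.trans hr)
  deriv_g r hr := h.deriv_g r (hS.trans hr)
  g_pos r hr := h.g_pos r (hS.trans hr)
  g_sq_le r hr := h.g_sq_le r (hS.trans hr)
  f_sq_le r hr := h.f_sq_le r (hS.trans hr)
  energy r hr := h.energy r (hS.trans hr)

theorem damping_mem (h : IsPosTail a b q R ψ f g) {r : ℝ} (hr : R ≤ r) :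
    2 * ψ r / r ∈ Icc 0 (2 / R) := by
  have hR := h.R_pos
  have hr0 : 0 < r := hR.trans_le hr
  obtain ⟨h0, h1⟩ := h.cutoff_mem r hr
  refine ⟨by positivity, ?_⟩
  apply div_le_div₀ <;> linarith

theorem g_lt_one (h : IsPosTail a b q R ψ f g) {r : ℝ} (hr : R ≤ r) : g r < 1 := by
  nlinarith [h.g_pos r hr, h.g_sq_le r hr, h.q_lt]

theorem abs_f_mul_g_le (h : IsPosTail a b q R ψ f g) {r : ℝ} (hr : R ≤ r) :
    |f r| * g r ≤ a + 1 := by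
  have h1 := h.f_sq_le r hr
  have h2 := h.g_lt_one hr
  have h3 := h.g_pos r hr
  rw [← sq_abs] at h1
  nlinarith [abs_nonneg (f r), sq_nonneg (|f r| - 1), mul_nonneg (abs_nonneg (f r)) h3.le]

theorem abs_f_le (h : IsPosTail a b q R ψ f g) {r : ℝ} (hr : R ≤ r) : |f r| ≤ a + 1 := by
  have h1 := h.f_sq_le r hr
  rw [← sq_abs] at h1
  nlinarith [abs_nonneg (f r), sq_nonneg (|f r| - 1)]

/-- The first component cannot stay positive. -/
theorem exists_f_nonpos (h : IsPosTail a b q R ψ f g) : ∃ r ≥ R, f r ≤ 0 := by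
  by_contra! hf
  have hb := h.b_pos
  have ha : 0 < a := by linarith [h.b_lt]
  have hq := h.q_lt
  have hmono : MonotoneOn g (Ici R) := by
    apply monotoneOn_of_hasDerivWithinAt_nonneg (f' := fun r => f r * (1 - g r ^ 2)) (convex_Ici R)
    · intro r hr
      exact (h.deriv_g r hr).continuousAt.continuousWithinAt
    · intro r hr
      rw [interior_Ici] at hr
      exact (h.deriv_g r (le_of_lt hr)).hasDerivWithinAt
    · intro r hr
      rw [interior_Ici] at hr
      have := h.g_sq_le r (le_of_lt hr)
      exact mul_nonneg (hf r (le_of_lt hr)).le (by linarith)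
  by_cases hsmall : ∀ r ≥ R, a * g r ^ 2 ≤ 3 / 2 * b
  · have hgR := h.g_pos R le_rfl
    refine not_bddAbove_of_le_deriv (c := g R * √(b / 4) * (1 - q)) (B := 1) ?_ h.deriv_g ?_
      fun r hr => (h.g_lt_one hr).le
    · have : 0 < 1 - q := by linarith
      positivity
    · intro r hr
      have h1 := h.g_sq_le r hr
      have h2 : g R ≤ g r := hmono self_mem_Ici hr hr
      have h3 := h.energy r hr
      have h4 := hsmall r hr
      have h5 : (g R * √(b / 4)) ^ 2 ≤ f r ^ 2 := by
        rw [mul_pow, sq_sqrt (by positivity)]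
        have h6 : g R ^ 2 ≤ g r ^ 2 := pow_le_pow_left₀ hgR.le h2 2
        calc g R ^ 2 * (b / 4) ≤ g r ^ 2 * (b / 4) := by gcongr
          _ ≤ g r ^ 2 * (b - a / 2 * g r ^ 2) := by
            apply mul_le_mul_of_nonneg_left _ (sq_nonneg _)
            linarith
          _ ≤ f r ^ 2 * (1 - g r ^ 2) := h3
          _ ≤ f r ^ 2 := by nlinarith [mul_nonneg (sq_nonneg (f r)) (sq_nonneg (g r))]
      have h6 := (sq_le_sq₀ (by positivity) (hf r hr).le).1 h5
      exact mul_le_mul h6 (by linarith) (by linarith) (hf r hr).le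
  · push Not at hsmall
    obtain ⟨S, hS, hgS⟩ := hsmall
    have hgS0 := h.g_pos S hS
    obtain ⟨M, hM⟩ : ∃ M, M * (1 - q) = a + 1 :=
      ⟨(a + 1) / (1 - q), div_mul_cancel₀ _ (by linarith)⟩
    have hM0 : 0 < M := by
      have : 0 < M * (1 - q) := by linarith
      exact pos_of_mul_pos_left this (by linarith)
    refine not_bddAbove_of_le_deriv (u := fun r => M * g r - f r) (R := S)
      (c := g S * (b / 2)) (B := M) (by positivity)
      (fun r hr => ((h.deriv_g r (hS.trans hr)).const_mul M).sub (h.deriv_f r (hS.trans hr)))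
      ?_ ?_
    · intro r hr
      have hr' := hS.trans hr
      have h2 : g S ≤ g r := hmono hS hr' hr
      have h1 := h.g_sq_le r hr'
      have h3 : a * g S ^ 2 ≤ a * g r ^ 2 := by gcongr
      have hfr := hf r hr'
      have h4 := h.abs_f_mul_g_le hr'
      rw [abs_of_pos hfr] at h4
      have h5 : 0 ≤ 2 * ψ r / r * f r := mul_nonneg (h.damping_mem hr').1 hfr.le
      have h6 : f r * (f r * g r) ≤ f r * (M * (1 - g r ^ 2)) := by
        apply mul_le_mul_of_nonneg_left _ hfr.le
        nlinarith
      have h7 : g S * (b / 2) ≤ g r * (a * g r ^ 2 - b) := by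
        apply mul_le_mul h2 (by linarith) (by positivity) (by linarith)
      nlinarith
    · intro r hr
      have := h.g_lt_one (hS.trans hr)
      have := hf r (hS.trans hr)
      nlinarith

theorem f_nonpos_of_le (h : IsPosTail a b q R ψ f g) (hR : f R ≤ 0) : ∀ r ≥ R, f r ≤ 0 := by
  refine le_const_of_deriv_neg h.deriv_f hR ?_
  intro r hr hfr
  have hg := h.g_pos r hr
  have he := h.energy r hr
  rw [hfr] at he ⊢
  have h1 : b - a / 2 * g r ^ 2 ≤ 0 := by
    by_contra! hlt
    have := mul_pos (pow_pos hg 2) hlt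
    linarith
  have hb := h.b_pos
  have := mul_pos hg (show 0 < a * g r ^ 2 - b by linarith)
  nlinarith

/-- Once the first component is nonpositive, it is controlled by the second one. -/
theorem exists_neg_f_le (h : IsPosTail a b q R ψ f g) (hf : ∀ r ≥ R, f r ≤ 0) :
    ∃ M > 0, ∀ r ≥ R, -f r ≤ M * g r := by
  have hb := h.b_pos
  have hab := h.b_lt
  have hq := h.q_lt
  have hR := h.R_pos
  have hRi : 0 < 2 / R := by positivity
  have hq0 : 0 ≤ q := (sq_nonneg _).trans (h.g_sq_le R le_rfl)
  obtain ⟨M, hM⟩ : ∃ M, M * (1 - q) = a + 1 + 2 / R + b + 1 :=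
    ⟨(a + 1 + 2 / R + b + 1) / (1 - q), div_mul_cancel₀ _ (by linarith)⟩
  have hM1 : 1 ≤ M := by
    by_contra! hlt
    nlinarith
  refine ⟨M, by linarith, ?_⟩
  by_contra! hcon
  obtain ⟨S, hS, hw⟩ := hcon
  have hkeep : ∀ r ≥ S, f r + M * g r ≤ f S + M * g S := by
    refine le_const_of_deriv_neg (fun r hr =>
      (h.deriv_f r (hS.trans hr)).add ((h.deriv_g r (hS.trans hr)).const_mul M)) le_rfl ?_
    intro r hr hreq
    have hr' := hS.trans hr
    have hg := h.g_pos r hr'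
    have hq1 := h.g_sq_le r hr'
    obtain ⟨hd0, hd1⟩ := h.damping_mem hr'
    have h4 := h.abs_f_mul_g_le hr'
    rw [abs_of_nonpos (hf r hr')] at h4
    set D := 2 * ψ r / r
    obtain ⟨F, hF⟩ : ∃ F, F = -f r := ⟨_, rfl⟩
    rw [← hF] at h4
    have hfF : f r = -F := by linarith
    rw [hfF] at hreq ⊢
    have hFg : M * g r < F := by linarith
    have hgF : g r < F := by nlinarith
    have hF0 : 0 < F := hg.trans hgF
    have e1 : F * (F * g r) ≥ 0 := by positivity
    have e2 : D * F ≤ 2 / R * F := by gcongr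
    have e3 : F * (M * (1 - q)) ≤ F * (M * (1 - g r ^ 2)) := by
      gcongr
    have e4 : 0 < a * g r ^ 3 := by
      have : 0 < a := by linarith
      positivity
    have e5 : F * (F * g r) ≤ F * (a + 1) := by gcongr
    have e6 : b * g r ≤ b * F := by gcongr
    rw [hM] at e3
    nlinarith
  refine not_bddAbove_of_le_deriv (u := fun r => -g r) (R := S) (B := 0)
    (c := -(f S + M * g S) * (1 - q)) (mul_pos (by linarith) (by linarith))
    (fun r hr => (h.deriv_g r (hS.trans hr)).neg) ?_ ?_
  · intro r hr
    have hr' := hS.trans hr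
    have h1 := h.g_sq_le r hr'
    have h2 := hkeep r hr
    have h3 : -(f S + M * g S) ≤ -f r := by nlinarith [h.g_pos r hr']
    rw [← neg_mul]
    exact mul_le_mul h3 (by linarith) (by linarith) (by linarith [hf r hr'])
  · intro r hr
    exact neg_nonpos.2 (h.g_pos r (hS.trans hr)).le

/-- The second component cannot stay away from the zero energy well. -/
theorem exists_g_sq_lt (h : IsPosTail a b q R ψ f g) (hf : ∀ r ≥ R, f r ≤ 0) :
    ∃ r ≥ R, a * g r ^ 2 < 3 / 2 * b := by
  by_contra! hcon
  have hb := h.b_pos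
  have ha : 0 < a := by linarith [h.b_lt]
  have hq := h.q_lt
  have hR := h.R_pos
  have hRi : 0 < 2 / R := by positivity
  obtain ⟨M, hM⟩ : ∃ M, M * (1 - q) = a + 1 + 2 / R :=
    ⟨(a + 1 + 2 / R) / (1 - q), div_mul_cancel₀ _ (by linarith)⟩
  have hM0 : 0 < M := by
    have : 0 < M * (1 - q) := by linarith
    exact pos_of_mul_pos_left this (by linarith)
  refine not_bddAbove_of_le_deriv (u := fun r => -f r - M * g r) (R := R)
    (c := 3 / 2 * b / a * (b / 2)) (B := a + 1) (by positivity)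
    (fun r hr => (h.deriv_f r hr).neg.sub ((h.deriv_g r hr).const_mul M)) ?_ ?_
  · intro r hr
    have hg := h.g_pos r hr
    have hg1 := h.g_lt_one hr
    have hq1 := h.g_sq_le r hr
    obtain ⟨hd0, hd1⟩ := h.damping_mem hr
    have h4 := h.abs_f_mul_g_le hr
    have hfr := hf r hr
    rw [abs_of_nonpos hfr] at h4
    set D := 2 * ψ r / r
    obtain ⟨F, hF⟩ : ∃ F, F = -f r := ⟨_, rfl⟩
    have hF0 : 0 ≤ F := by linarith
    rw [← hF] at h4
    have hfF : f r = -F := by linarith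
    rw [hfF]
    have h5 := hcon r hr
    have e0 : 3 / 2 * b / a ≤ g r := by
      rw [div_le_iff₀ ha]
      nlinarith
    have e1 : 3 / 2 * b / a * (b / 2) ≤ g r * (a * g r ^ 2 - b) :=
      mul_le_mul e0 (by linarith) (by positivity) hg.le
    have e2 : D * F ≤ 2 / R * F := by gcongr
    have e3 : F * (M * (1 - q)) ≤ F * (M * (1 - g r ^ 2)) := by
      gcongr
    have e5 : F * (F * g r) ≤ F * (a + 1) := by gcongr
    rw [hM] at e3
    nlinarith
  · intro r hr
    have h1 := h.abs_f_le hr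
    have h2 := mul_pos hM0 (h.g_pos r hr)
    linarith [neg_le_abs (f r)]

theorem g_antitoneOn (h : IsPosTail a b q R ψ f g) (hf : ∀ r ≥ R, f r ≤ 0) :
    AntitoneOn g (Ici R) := by
  have hq := h.q_lt
  apply antitoneOn_of_hasDerivWithinAt_nonpos (f' := fun r => f r * (1 - g r ^ 2)) (convex_Ici R)
  · intro r hr
    exact (h.deriv_g r hr).continuousAt.continuousWithinAt
  · intro r hr
    rw [interior_Ici] at hr
    exact (h.deriv_g r (le_of_lt hr)).hasDerivWithinAt
  · intro r hr
    rw [interior_Ici] at hr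
    have := h.g_sq_le r (le_of_lt hr)
    exact mul_nonpos_of_nonpos_of_nonneg (hf r (le_of_lt hr)) (by linarith)

theorem deriv_g_le (h : IsPosTail a b q R ψ f g) (hf : ∀ r ≥ R, f r ≤ 0) {k r : ℝ}
    (hr : R ≤ r) (hk : k ^ 2 ≤ (b - a / 2 * g r ^ 2) * (1 - g r ^ 2)) :
    f r * (1 - g r ^ 2) ≤ -k * g r := by
  have h1 : 0 < 1 - g r ^ 2 := by linarith [h.g_sq_le r hr, h.q_lt]
  have h2 : (k * g r) ^ 2 ≤ (-f r * (1 - g r ^ 2)) ^ 2 := by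
    calc (k * g r) ^ 2 = g r ^ 2 * k ^ 2 := by ring
      _ ≤ g r ^ 2 * ((b - a / 2 * g r ^ 2) * (1 - g r ^ 2)) := by gcongr
      _ = g r ^ 2 * (b - a / 2 * g r ^ 2) * (1 - g r ^ 2) := by ring
      _ ≤ f r ^ 2 * (1 - g r ^ 2) * (1 - g r ^ 2) :=
        mul_le_mul_of_nonneg_right (h.energy r hr) h1.le
      _ = _ := by ring
  have h3 := abs_le_of_sq_le_sq h2 (mul_nonneg (neg_nonneg.2 (hf r hr)) h1.le)
  linarith [le_abs_self (k * g r)]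

theorem tendsto_g (h : IsPosTail a b q R ψ f g) (hf : ∀ r ≥ R, f r ≤ 0) :
    Tendsto g atTop (𝓝 0) := by
  have hb := h.b_pos
  have ha : 0 < a := by linarith [h.b_lt]
  have hq := h.q_lt
  obtain ⟨S, hS, hgS⟩ := h.exists_g_sq_lt hf
  have hk : 0 < √(b / 4 * (1 - q)) := by
    have : 0 < 1 - q := by linarith
    positivity
  have hdec := le_exp_of_deriv_le (u := g) (R := S) (k := √(b / 4 * (1 - q)))
    (fun r hr => h.deriv_g r (hS.trans hr)) (fun r hr => by
      have hr' := hS.trans hr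
      refine h.deriv_g_le hf hr' ?_
      have h1 := h.g_sq_le r hr'
      have h2 : g r ≤ g S := h.g_antitoneOn hf hS hr' hr
      have h3 : a * g r ^ 2 ≤ a * g S ^ 2 := by
        have := h.g_pos r hr'
        gcongr
      rw [sq_sqrt (mul_nonneg (by positivity) (by linarith))]
      apply mul_le_mul <;> linarith)
  have hlim : Tendsto (fun r => g S * exp (√(b / 4 * (1 - q)) * S) *
      exp (-√(b / 4 * (1 - q)) * r)) atTop (𝓝 0) := by
    have h1 : Tendsto (fun r => -√(b / 4 * (1 - q)) * r) atTop atBot :=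
      tendsto_id.const_mul_atTop_of_neg (by linarith)
    simpa using (tendsto_exp_atBot.comp h1).const_mul (g S * exp (√(b / 4 * (1 - q)) * S))
  refine tendsto_of_tendsto_of_tendsto_of_le_of_le' tendsto_const_nhds hlim ?_ ?_
  · filter_upwards [eventually_ge_atTop R] with r hr using (h.g_pos r hr).le
  · filter_upwards [eventually_ge_atTop S] with r hr using hdec r hr

theorem exponential_bound (h : IsPosTail a b q R ψ f g) {k : ℝ} (hk : k ^ 2 < b) :
    ∃ C S, ∀ r ≥ S, |f r| + |g r| ≤ C * exp (-k * r) := by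
  obtain ⟨T, hT, hfT⟩ := h.exists_f_nonpos
  replace h := h.mono hT
  have hf := h.f_nonpos_of_le hfT
  obtain ⟨M, hM, hMg⟩ := h.exists_neg_f_le hf
  have hg := h.tendsto_g hf
  have hlim : Tendsto (fun r => (b - a / 2 * g r ^ 2) * (1 - g r ^ 2)) atTop (𝓝 b) := by
    have := ((((hg.pow 2).const_mul (a / 2)).const_sub b)).mul ((hg.pow 2).const_sub 1)
    simpa using this
  obtain ⟨S, hS⟩ := eventually_atTop.1 ((hlim.eventually (lt_mem_nhds hk)).and
    (eventually_ge_atTop T))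
  have hdec := le_exp_of_deriv_le (u := g) (R := S) (k := k)
    (fun r hr => h.deriv_g r (hS r hr).2) (fun r hr => h.deriv_g_le hf (hS r hr).2 (hS r hr).1.le)
  refine ⟨(M + 1) * (g S * exp (k * S)), S, fun r hr => ?_⟩
  have hr' := (hS r hr).2
  rw [abs_of_nonpos (hf r hr'), abs_of_pos (h.g_pos r hr')]
  have h1 := hMg r hr'
  have h2 := hdec r hr
  nlinarith

end IsPosTail

/-- A simple zero of `g` in `(0, ∞)` is a sign change. -/
theorem changesSignAt_of_hasDerivAt {g : ℝ → ℝ} {r c : ℝ} (hr : 0 < r) (hg : g r = 0)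
    (hd : HasDerivAt g c r) (hc : c ≠ 0) : ChangesSignAt g (Ioi 0) r := by
  have hslope : ∀ᶠ s in 𝓝[≠] r, 0 < c * slope g r s := by
    have h1 := (hasDerivAt_iff_tendsto_slope.1 hd).const_mul c
    exact h1.eventually (lt_mem_nhds (mul_self_pos.2 hc))
  rw [eventually_nhdsWithin_iff, Metric.eventually_nhds_iff] at hslope
  obtain ⟨δ, hδ, hs⟩ := hslope
  have key : ∀ t ∈ Ioo 0 δ, g (r - t) * g (r + t) < 0 := by
    intro t ht
    have h1 := hs (y := r - t) (by simpa [abs_of_pos ht.1] using ht.2) (by simpa using ht.1.ne')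
    have h2 := hs (y := r + t) (by simpa [abs_of_pos ht.1] using ht.2) (by simpa using ht.1.ne')
    rw [slope_def_field, hg] at h1 h2
    have ht0 := ht.1
    have h3 := mul_pos h1 h2
    have h4 : c * ((g (r - t) - 0) / (r - t - r)) * (c * ((g (r + t) - 0) / (r + t - r)))
        = (c / t) ^ 2 * -(g (r - t) * g (r + t)) := by
      have e1 : r - t - r = -t := by ring
      have e2 : r + t - r = t := by ring
      rw [e1, e2]
      field_simp
      ring
    rw [h4] at h3
    have h5 := pos_of_mul_pos_right h3 (sq_nonneg _)
    linarith
  refine ⟨hg, min (δ / 2) (r / 2), by positivity, ?_, ?_, ?_⟩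
  · intro s hs
    have := min_le_right (δ / 2) (r / 2)
    have := hs.1
    exact mem_Ioi.2 (by linarith)
  · refine key _ ⟨by positivity, ?_⟩
    have := min_le_left (δ / 2) (r / 2)
    linarith
  · intro t ht
    refine (key t ⟨ht.1, ?_⟩).le
    have := min_le_left (δ / 2) (r / 2)
    linarith [ht.2]

/-- A function bounded by `C exp (-k r)` far out and continuous on `[0, ∞)` obeys such a bound
everywhere. -/
theorem exists_forall_le_exp {u : ℝ → ℝ} {C S k : ℝ} (hk : 0 ≤ k) (hu : ContinuousOn u (Ici 0))
    (hC : ∀ r ≥ S, u r ≤ C * exp (-k * r)) : ∃ C > 0, ∀ r ≥ 0, u r ≤ C * exp (-k * r) := by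
  obtain ⟨B, hB⟩ := (isCompact_Icc (a := (0 : ℝ)) (b := S)).bddAbove_image
    (hu.mono fun r hr => hr.1)
  refine ⟨max C (|B| * exp (k * S)) + 1, ?_, ?_⟩
  · have : 0 ≤ |B| * exp (k * S) := by positivity
    linarith [le_max_right C (|B| * exp (k * S))]
  · intro r hr
    rcases le_total S r with h | h
    · refine (hC r h).trans ?_
      gcongr
      linarith [le_max_left C (|B| * exp (k * S))]
    · have h1 : u r ≤ B := hB ⟨r, ⟨hr, h⟩, rfl⟩
      have h2 : 1 ≤ exp (k * S) * exp (-k * r) := by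
        rw [← exp_add]
        apply one_le_exp
        nlinarith
      calc u r ≤ |B| * 1 := by linarith [le_abs_self B]
        _ ≤ |B| * (exp (k * S) * exp (-k * r)) := by gcongr
        _ = |B| * exp (k * S) * exp (-k * r) := by ring
        _ ≤ _ := by
          gcongr
          linarith [le_max_right C (|B| * exp (k * S))]

namespace IsRegSolOn

variable {a b x : ℝ} {φ : ℝ → ℝ → ℝ} {f g : ℝ → ℝ}

theorem g_sq_lt_one (h : IsRegSolOn a b φ x f g (Ici 0)) (hx : x ∈ Ioo (0 : ℝ) 1) :
    ∀ r ≥ 0, g r ^ 2 < 1 := by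
  obtain ⟨-, hg0, hfc, hgc, hd⟩ := h
  have := pos_of_hasDerivAt_mul (u := fun r => 1 - g r ^ 2) (c := fun r => -2 * g r * f r)
    (by fun_prop) (by fun_prop) (fun r hr => by
      have h1 := ((hd r (le_of_lt hr) hr).2.pow 2).const_sub 1
      refine h1.congr_deriv ?_
      push_cast
      ring) (by simp only [hg0]; nlinarith [hx.1, hx.2])
  intro r hr
  linarith [this r hr]

theorem hasDerivAt_ham (h : IsRegSolOn a b φ x f g (Ici 0)) {r : ℝ} (hr : 0 < r) :
    HasDerivAt (fun r => Ham a b (f r) (g r))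
      (-(2 * φ (f r) (g r) / r * f r ^ 2 * (1 - g r ^ 2))) r := by
  obtain ⟨hf, hg⟩ := h.2.2.2.2 r hr.le hr
  have h1 := ((((hf.pow 2).const_mul (1 / 2)).mul ((hg.pow 2).const_sub 1)).add
    ((hg.pow 4).const_mul (a / 4))).sub ((hg.pow 2).const_mul (b / 2))
  refine h1.congr_deriv ?_
  simp only [Pi.pow_apply]
  push_cast
  ring

theorem ham_antitoneOn (h : IsRegSolOn a b φ x f g (Ici 0)) (hx : x ∈ Ioo (0 : ℝ) 1)
    (hφ : ∀ u v, 0 ≤ φ u v) : AntitoneOn (fun r => Ham a b (f r) (g r)) (Ici 0) := by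
  have hfc := h.2.2.1
  have hgc := h.2.2.2.1
  apply antitoneOn_of_hasDerivWithinAt_nonpos
    (f' := fun r => -(2 * φ (f r) (g r) / r * f r ^ 2 * (1 - g r ^ 2))) (convex_Ici 0)
  · unfold Ham
    fun_prop
  · intro r hr
    rw [interior_Ici] at hr
    exact (h.hasDerivAt_ham hr).hasDerivWithinAt
  · intro r hr
    rw [interior_Ici, mem_Ioi] at hr
    have h1 := h.g_sq_lt_one hx r hr.le
    have h2 := hφ (f r) (g r)
    have h3 : 0 ≤ 1 - g r ^ 2 := by linarith
    exact neg_nonpos.2 (by positivity)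

/-- A nontrivial solution with bounded components never reaches the origin. -/
theorem f_ne_zero (h : IsRegSolOn a b φ x f g (Ici 0)) (hx : x ∈ Ioo (0 : ℝ) 1)
    (ha : 0 ≤ a) (hb : 0 ≤ b) (hφ : ∀ u v, φ u v ≤ 1)
    (hg1 : ∀ r ≥ 0, g r ^ 2 < 1) (hfa : ∀ r ≥ 0, f r ^ 2 ≤ a)
    {r : ℝ} (hr : 0 < r) (hgr : g r = 0) : f r ≠ 0 := by
  intro hfr
  obtain ⟨-, hg0, hfc, hgc, hd⟩ := h
  set k := a + b + 1 with hk
  set N : ℝ → ℝ := fun s => (f s ^ 2 + g s ^ 2) * (s ^ 4 * exp (k * s)) with hN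
  set N' : ℝ → ℝ := fun s =>
    (2 * f s * (g s * (f s ^ 2 - a * g s ^ 2 + b) - 2 * φ (f s) (g s) / s * f s)
      + 2 * g s * (f s * (1 - g s ^ 2))) * (s ^ 4 * exp (k * s))
    + (f s ^ 2 + g s ^ 2) * (4 * s ^ 3 * exp (k * s) + s ^ 4 * (exp (k * s) * k)) with hN'
  have hNd : ∀ s > 0, HasDerivAt N (N' s) s := by
    intro s hs
    obtain ⟨h1, h2⟩ := hd s hs.le hs
    have h3 := ((h1.pow 2).add (h2.pow 2)).mul
      (((hasDerivAt_id s).pow 4).mul ((hasDerivAt_id s).const_mul k).exp)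
    refine h3.congr_deriv ?_
    simp [hN']
  have hmono : MonotoneOn N (Ici 0) := by
    apply monotoneOn_of_hasDerivWithinAt_nonneg (f' := N') (convex_Ici 0)
    · fun_prop
    · intro s hs
      rw [interior_Ici] at hs
      exact (hNd s hs).hasDerivWithinAt
    · intro s hs
      rw [interior_Ici, mem_Ioi] at hs
      have e : N' s = s ^ 4 * exp (k * s) *
          (2 * (f s * g s) * (f s ^ 2 - a * g s ^ 2 + b + (1 - g s ^ 2)) + k * (f s ^ 2 + g s ^ 2))
          + s ^ 3 * exp (k * s) * (4 * ((1 - φ (f s) (g s)) * f s ^ 2 + g s ^ 2)) := by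
        simp only [hN']
        field_simp
        ring
      rw [e]
      have h1 := hg1 s hs.le
      have h2 := hfa s hs.le
      have h3 : 0 ≤ 1 - φ (f s) (g s) := sub_nonneg.2 (hφ _ _)
      have h4 : |f s ^ 2 - a * g s ^ 2 + b + (1 - g s ^ 2)| ≤ k := by
        rw [abs_le]
        constructor <;> nlinarith [sq_nonneg (f s), sq_nonneg (g s)]
      have h5 : |2 * (f s * g s)| ≤ f s ^ 2 + g s ^ 2 := by
        rw [abs_le]
        constructor <;> nlinarith [sq_nonneg (f s + g s), sq_nonneg (f s - g s)]
      have h6 : |2 * (f s * g s) * (f s ^ 2 - a * g s ^ 2 + b + (1 - g s ^ 2))|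
          ≤ (f s ^ 2 + g s ^ 2) * k := by
        rw [abs_mul]
        exact mul_le_mul h5 h4 (abs_nonneg _) (by positivity)
      have h7 := neg_le_of_abs_le h6
      have h8 : 0 ≤ 2 * (f s * g s) * (f s ^ 2 - a * g s ^ 2 + b + (1 - g s ^ 2))
          + k * (f s ^ 2 + g s ^ 2) := by linarith
      positivity
  have hzero : ∀ s ∈ Ioo 0 r, g s = 0 := by
    intro s hs
    have h1 : N s ≤ N r := hmono hs.1.le hr.le hs.2.le
    simp only [hN, hfr, hgr] at h1
    have hs0 := hs.1
    have h2 : 0 < s ^ 4 * exp (k * s) := by positivity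
    have h3 : f s ^ 2 + g s ^ 2 ≤ 0 := by
      by_contra! hlt
      have := mul_pos hlt h2
      norm_num at h1
      linarith
    have h4 : g s ^ 2 = 0 := by nlinarith [sq_nonneg (f s), sq_nonneg (g s)]
    exact pow_eq_zero_iff two_ne_zero |>.1 h4
  have hlim : Tendsto g (𝓝[>] 0) (𝓝 x) := by
    have := (hgc 0 self_mem_Ici).mono_left (nhdsWithin_mono 0 Ioi_subset_Ici_self)
    rwa [hg0] at this
  have hlim0 : Tendsto g (𝓝[>] 0) (𝓝 0) := by
    refine tendsto_const_nhds.congr' ?_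
    filter_upwards [Ioo_mem_nhdsGT hr] with s hs using (hzero s hs).symm
  exact hx.1.ne' (tendsto_nhds_unique hlim hlim0)

end IsRegSolOn

/-- Lemma 2.7: if `g_{x,η}` changes sign finitely many times and the
limit of the energy is nonnegative, then the solution decays exponentially and tends
to `(0,0)`. -/
theorem exponential_decay (a b η : ℝ) (hb : 0 < b) (hab : 2 * b < a)
    (hη : η ∈ Ioo 0 (Real.sqrt (a - b) - Real.sqrt (a / 2)))
    (φ : ℝ → ℝ → ℝ) (hφ : IsCutoff a b η φ)
    (x : ℝ) (hx : x ∈ Ioo (0 : ℝ) 1)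
    (f g : ℝ → ℝ) (hsol : IsRegSolOn a b φ x f g (Ici 0))
    (hfin : {r | ChangesSignAt g (Ioi 0) r}.Finite)
    (hlim : ∃ L, 0 ≤ L ∧ Tendsto (fun r => Ham a b (f r) (g r)) atTop (nhds L)) :
    (∃ C > 0, ∀ r ≥ 0,
      |f r| + |g r| ≤ C * Real.exp (-(min (b / 2) ((2 * a - b) / (2 * a))) * r)) ∧
    Tendsto (fun r => (f r, g r)) atTop (nhds ((0 : ℝ), (0 : ℝ))) := by
  obtain ⟨L, hL, hHL⟩ := hlim
  have ha : 0 < a := by linarith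
  have hanti := hsol.ham_antitoneOn hx fun u v => (hφ.1 u v).1
  have hg1 := hsol.g_sq_lt_one hx
  obtain ⟨hf0, hg0, hfc, hgc, hd⟩ := id hsol
  have hx1 : x ^ 2 < 1 := by nlinarith [hx.1, hx.2]
  have hH0 : ∀ r ≥ 0, 0 ≤ Ham a b (f r) (g r) := by
    intro r hr
    refine hL.trans (le_of_tendsto hHL ?_)
    filter_upwards [eventually_ge_atTop r] with s hs using hanti hr (hr.trans hs) hs
  have hHx : ∀ r ≥ 0, Ham a b (f r) (g r) ≤ a / 4 * x ^ 4 - b / 2 * x ^ 2 := by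
    intro r hr
    have h1 : Ham a b (f r) (g r) ≤ Ham a b (f 0) (g 0) := hanti self_mem_Ici hr hr
    rw [hf0, hg0] at h1
    refine h1.trans (le_of_eq ?_)
    unfold Ham
    ring
  have hxb : 2 * b ≤ a * x ^ 2 := by
    have h1 := (hH0 0 le_rfl).trans (hHx 0 le_rfl)
    have h2 : 0 < x ^ 2 := pow_pos hx.1 2
    by_contra! hlt
    nlinarith
  have hgx : ∀ r ≥ 0, g r ^ 2 ≤ x ^ 2 := by
    intro r hr
    have h1 := hHx r hr
    have h2 := hg1 r hr
    unfold Ham at h1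
    by_contra! hlt
    have h3 : 0 ≤ f r ^ 2 * (1 - g r ^ 2) := mul_nonneg (sq_nonneg _) (by linarith)
    have h4 : 0 < (g r ^ 2 - x ^ 2) * (a * (g r ^ 2 + x ^ 2) - 2 * b) := by
      apply mul_pos (by linarith)
      nlinarith
    nlinarith
  have hfa : ∀ r ≥ 0, f r ^ 2 ≤ a := by
    intro r hr
    have h1 := hHx r hr
    have h2 := hg1 r hr
    unfold Ham at h1
    have h3 : a / 4 * x ^ 4 - b / 2 * x ^ 2 ≤ (a - 2 * b) / 4 := by
      have : 0 ≤ (1 - x ^ 2) * (a * x ^ 2 + a - 2 * b) :=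
        mul_nonneg (by linarith) (by linarith)
      nlinarith
    by_contra! hlt
    have h4 : 0 < (f r ^ 2 - a) * (1 - g r ^ 2) := mul_pos (by linarith) (by linarith)
    have h5 : 0 ≤ (1 - g r ^ 2) * (a * (1 - g r ^ 2) + 2 * b) :=
      mul_nonneg (by linarith) (by nlinarith)
    nlinarith
  have hsimple : ∀ r > 0, g r = 0 → ChangesSignAt g (Ioi 0) r := by
    intro r hr hgr
    have h1 := (hd r hr.le hr).2
    have h2 := hsol.f_ne_zero hx ha.le hb.le (fun u v => (hφ.1 u v).2) hg1 hfa hr hgr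
    refine changesSignAt_of_hasDerivAt hr hgr h1 ?_
    simpa [hgr] using h2
  obtain ⟨R, hR0, hR⟩ : ∃ R > 0, ∀ r ≥ R, g r ≠ 0 := by
    obtain ⟨B, hB⟩ := hfin.bddAbove
    refine ⟨max B 0 + 1, by positivity, fun r hr hgr => ?_⟩
    have hr0 : 0 < r := by linarith [le_max_right B 0]
    have : r ≤ B := hB (hsimple r hr0 hgr)
    linarith [le_max_left B 0]
  have hsign : (∀ r ≥ R, 0 < g r) ∨ ∀ r ≥ R, g r < 0 := by
    by_contra! hcon
    obtain ⟨⟨s, hs, hgs⟩, t, ht, hgt⟩ := hcon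
    obtain ⟨r, hr, hgr⟩ := (isPreconnected_Ici (a := R)).intermediate_value hs ht
      (hgc.mono (Ici_subset_Ici.2 hR0.le)) ⟨hgs, hgt⟩
    exact hR r hr hgr
  set k := min (b / 2) ((2 * a - b) / (2 * a)) with hk
  have hk0 : 0 < k := by
    have : 0 < 2 * a - b := by linarith
    positivity
  have hk1 : k ≤ 1 := by
    refine (min_le_right _ _).trans ?_
    rw [div_le_one (by positivity)]
    linarith
  have hkb : k ^ 2 < b := by
    have : k ≤ b / 2 := min_le_left _ _
    nlinarith
  have henergy : ∀ r ≥ R, g r ^ 2 * (b - a / 2 * g r ^ 2) ≤ f r ^ 2 * (1 - g r ^ 2) := by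
    intro r hr
    have h1 := hH0 r (hR0.le.trans hr)
    unfold Ham at h1
    nlinarith
  obtain ⟨C, S, hCS⟩ : ∃ C S, ∀ r ≥ S, |f r| + |g r| ≤ C * exp (-k * r) := by
    rcases hsign with hpos | hneg
    · have htail : IsPosTail a b (x ^ 2) R (fun r => φ (f r) (g r)) f g :=
        { b_pos := hb
          b_lt := hab
          q_lt := hx1
          R_pos := hR0
          cutoff_mem := fun r _ => hφ.1 _ _
          deriv_f := fun r hr => (hd r (hR0.le.trans hr) (hR0.trans_le hr)).1
          deriv_g := fun r hr => (hd r (hR0.le.trans hr) (hR0.trans_le hr)).2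
          g_pos := hpos
          g_sq_le := fun r hr => hgx r (hR0.le.trans hr)
          f_sq_le := fun r hr => hfa r (hR0.le.trans hr)
          energy := henergy }
      exact htail.exponential_bound hkb
    · have htail : IsPosTail a b (x ^ 2) R (fun r => φ (f r) (g r)) (fun r => -f r)
          (fun r => -g r) :=
        { b_pos := hb
          b_lt := hab
          q_lt := hx1
          R_pos := hR0
          cutoff_mem := fun r _ => hφ.1 _ _
          deriv_f := fun r hr => by
            refine (hd r (hR0.le.trans hr) (hR0.trans_le hr)).1.neg.congr_deriv ?_
            ring
          deriv_g := fun r hr => by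
            refine (hd r (hR0.le.trans hr) (hR0.trans_le hr)).2.neg.congr_deriv ?_
            ring
          g_pos := fun r hr => neg_pos.2 (hneg r hr)
          g_sq_le := fun r hr => by simpa using hgx r (hR0.le.trans hr)
          f_sq_le := fun r hr => by simpa using hfa r (hR0.le.trans hr)
          energy := fun r hr => by simpa using henergy r hr }
      simpa only [abs_neg] using htail.exponential_bound hkb
  have hbound := exists_forall_le_exp (u := fun r => |f r| + |g r|) hk0.le
    (hfc.abs.add hgc.abs) hCS
  refine ⟨hbound, ?_⟩
  obtain ⟨C, -, hC⟩ := hbound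
  have hlim : Tendsto (fun r => C * exp (-k * r)) atTop (𝓝 0) := by
    have h1 : Tendsto (fun r => -k * r) atTop atBot :=
      tendsto_id.const_mul_atTop_of_neg (by linarith)
    simpa using (tendsto_exp_atBot.comp h1).const_mul C
  refine Tendsto.prodMk_nhds ?_ ?_
  · refine squeeze_zero_norm' ?_ hlim
    filter_upwards [eventually_ge_atTop 0] with r hr
    rw [norm_eq_abs]
    linarith [hC r hr, abs_nonneg (g r)]
  · refine squeeze_zero_norm' ?_ hlim
    filter_upwards [eventually_ge_atTop 0] with r hr
    rw [norm_eq_abs]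
    linarith [hC r hr, abs_nonneg (f r)]
end
end

section
/- Let a, b > 0 with a − 2b > 0, η ∈ (0, √(a−b) − √(a/2)), φ_η an admissible cutoff, and k ∈ ℕ. Then the set A_k = {x ∈ (0,1) : lim_{r→+∞} H(f_{x,η}, g_{x,η})(r) < 0 and g_{x,η} changes sign exactly k times on (0,∞)} is an open subset of ℝ. -/
open Real Set Filter Topology

noncomputable section

section Gronwall

/-- Grönwall's inequality, for a function that need only be differentiable in the interior. -/
lemma le_mul_exp_of_hasDerivAt_le {E E' : ℝ → ℝ} {C c d : ℝ} (hcd : c ≤ d)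
    (hE : ContinuousOn E (Icc c d)) (hE' : ∀ r ∈ Ioo c d, HasDerivAt E (E' r) r)
    (hle : ∀ r ∈ Ioo c d, E' r ≤ C * E r) : E d ≤ E c * exp (C * (d - c)) := by
  have hanti : AntitoneOn (fun r => E r * exp (-(C * r))) (Icc c d) := by
    refine antitoneOn_of_hasDerivWithinAt_nonpos (convex_Icc c d)
      (f' := fun r => (E' r - C * E r) * exp (-(C * r)))
      (hE.mul (by fun_prop)) (fun r hr => ?_) (fun r hr => ?_)
    · rw [interior_Icc] at hr
      have h1 : HasDerivAt (fun r : ℝ => exp (-(C * r))) (exp (-(C * r)) * (-(C * 1))) r :=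
        ((hasDerivAt_id r).const_mul C).neg.exp
      exact (((hE' r hr).mul h1).congr_deriv (by ring)).hasDerivWithinAt
    · rw [interior_Icc] at hr
      exact mul_nonpos_of_nonpos_of_nonneg (by linarith [hle r hr]) (exp_pos _).le
  have h := hanti (left_mem_Icc.2 hcd) (right_mem_Icc.2 hcd) hcd
  have h2 := mul_le_mul_of_nonneg_right h (exp_pos (C * d)).le
  simp only [mul_assoc, ← exp_add] at h2
  calc E d = E d * exp (-(C * d) + C * d) := by simp
    _ ≤ E c * exp (-(C * c) + C * d) := h2
    _ = E c * exp (C * (d - c)) := by ring_nf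

lemma mul_exp_le_of_le_hasDerivAt {E E' : ℝ → ℝ} {C c d : ℝ} (hcd : c ≤ d)
    (hE : ContinuousOn E (Icc c d)) (hE' : ∀ r ∈ Ioo c d, HasDerivAt E (E' r) r)
    (hle : ∀ r ∈ Ioo c d, -(C * E r) ≤ E' r) : E c * exp (-(C * (d - c))) ≤ E d := by
  have h := le_mul_exp_of_hasDerivAt_le (E := fun r => -E r) (C := -C) hcd hE.neg
    (fun r hr => (hE' r hr).neg) (fun r hr => by linarith [hle r hr])
  rw [show -C * (d - c) = -(C * (d - c)) by ring] at h
  linarith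

end Gronwall

section Lipschitz

lemma abs_mul_le_mul_sq_add_sq {u v w d L : ℝ} (hL : 0 ≤ L) (hw : |w| ≤ max |u| |v|)
    (hd : |d| ≤ L * max |u| |v|) : |w * d| ≤ L * (u ^ 2 + v ^ 2) := by
  have hm : max |u| |v| ^ 2 ≤ u ^ 2 + v ^ 2 := by
    rcases max_cases |u| |v| with h | h <;> rw [h.1, sq_abs] <;> nlinarith [sq_nonneg u, sq_nonneg v]
  have hm0 : 0 ≤ max |u| |v| := (abs_nonneg u).trans (le_max_left _ _)
  calc |w * d| = |w| * |d| := abs_mul _ _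
    _ ≤ max |u| |v| * (L * max |u| |v|) := mul_le_mul hw hd (abs_nonneg _) hm0
    _ = L * max |u| |v| ^ 2 := by ring
    _ ≤ _ := mul_le_mul_of_nonneg_left hm hL

lemma ContDiff.exists_box_lipschitz {h : ℝ × ℝ → ℝ} (hh : ContDiff ℝ 1 h) (M : ℝ) :
    ∃ L, 0 ≤ L ∧ ∀ f₁ g₁ f₂ g₂ w : ℝ, |f₁| ≤ M → |g₁| ≤ 1 → |f₂| ≤ M → |g₂| ≤ 1 →
      |w| ≤ max |f₁ - f₂| |g₁ - g₂| →
      |w * (h (f₁, g₁) - h (f₂, g₂))| ≤ L * ((f₁ - f₂) ^ 2 + (g₁ - g₂) ^ 2) := by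
  obtain ⟨K, hK⟩ := (hh.locallyLipschitz.locallyLipschitzOn
    (s := Icc (-M) M ×ˢ Icc (-1 : ℝ) 1)).exists_lipschitzOnWith_of_compact
      (isCompact_Icc.prod isCompact_Icc)
  refine ⟨K, K.2, fun f₁ g₁ f₂ g₂ w hf₁ hg₁ hf₂ hg₂ hw => ?_⟩
  refine abs_mul_le_mul_sq_add_sq K.2 hw ?_
  have := hK.dist_le_mul (f₁, g₁) ⟨abs_le.1 hf₁, abs_le.1 hg₁⟩
    (f₂, g₂) ⟨abs_le.1 hf₂, abs_le.1 hg₂⟩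
  simpa [Prod.dist_eq, Real.dist_eq] using this

end Lipschitz

section Cutoff

variable {a b η : ℝ} {φ : ℝ → ℝ → ℝ}

lemma IsCutoff.contDiff (hφ : IsCutoff a b η φ) (hη : 0 < η) :
    ContDiff ℝ 1 (fun p : ℝ × ℝ => φ p.1 p.2) := by
  rw [contDiff_iff_contDiffAt]
  rintro ⟨f, g⟩
  by_cases hf : |f| < √(a - b)
  · have hmem : Ioo (-√(a - b)) √(a - b) ×ˢ (univ : Set ℝ) ∈ 𝓝 (f, g) :=
      (isOpen_Ioo.prod isOpen_univ).mem_nhds ⟨abs_lt.1 hf, mem_univ _⟩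
    exact (hφ.2.1.contDiffAt hmem).of_le (by exact_mod_cast le_top)
  · have hlt : √(a - b) - η / 2 < |f| := by linarith
    have hcont : Continuous fun p : ℝ × ℝ => |p.1| := by fun_prop
    have hev : ∀ᶠ p : ℝ × ℝ in 𝓝 (f, g), √(a - b) - η / 2 < |p.1| :=
      (hcont.tendsto (f, g)).eventually (lt_mem_nhds hlt)
    refine (contDiffAt_const (c := (0 : ℝ))).congr_of_eventuallyEq ?_
    filter_upwards [hev] with p hp using hφ.2.2.2.1 _ _ hp.le

end Cutoff

section Solution

variable {a b η x : ℝ} {φ : ℝ → ℝ → ℝ} {f g : ℝ → ℝ}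

lemma Ham_sub (a b f g : ℝ) : Ham a b f g - (a / 4 - b / 2) =
    (1 - g ^ 2) / 4 * (2 * f ^ 2 - a * g ^ 2 - (a - 2 * b)) := by
  unfold Ham; ring

lemma IsRegSolOn.sq_lt_one (h : IsRegSolOn a b φ x f g (Ici 0)) (hx : x ∈ Ioo (0 : ℝ) 1)
    {r : ℝ} (hr : 0 ≤ r) : g r ^ 2 < 1 := by
  obtain ⟨-, hg0, hfc, hgc, hd⟩ := h
  have hne : ∀ r, 0 ≤ r → 1 - g r ^ 2 ≠ 0 := by
    intro r hr hzero
    have hsub : Icc 0 r ⊆ Ici 0 := fun _ hs => hs.1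
    obtain ⟨C, hC⟩ := isCompact_Icc.exists_bound_of_continuousOn
      ((hfc.mono hsub).mul (hgc.mono hsub))
    have hE := mul_exp_le_of_le_hasDerivAt (E := fun s => (1 - g s ^ 2) ^ 2) (C := 4 * C) hr
      ((continuousOn_const.sub ((hgc.mono hsub).pow 2)).pow 2)
      (E' := fun s => -(4 * (f s * g s)) * (1 - g s ^ 2) ^ 2)
      (fun s hs => ((((hd s hs.1.le hs.1).2.pow 2).const_sub 1).pow 2).congr_deriv
        (by simp only [Pi.pow_apply]; push_cast; ring))
      (fun s hs => by
        have h1 := hC s ⟨hs.1.le, hs.2.le⟩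
        rw [Real.norm_eq_abs] at h1
        have h2 := (abs_le.1 h1).2
        simp only [Pi.mul_apply] at h2
        nlinarith [sq_nonneg (1 - g s ^ 2)])
    simp only [hzero, hg0] at hE
    have hpos : 0 < 1 - x ^ 2 := by nlinarith [hx.1, hx.2]
    have := mul_pos (pow_pos hpos 2) (exp_pos (-(4 * C * (r - 0))))
    norm_num at hE this
    linarith
  by_contra hcon
  push Not at hcon
  have hsub : Icc 0 r ⊆ Ici 0 := fun _ hs => hs.1
  have hcont : ContinuousOn (fun s => 1 - g s ^ 2) (Icc 0 r) :=
    continuousOn_const.sub ((hgc.mono hsub).pow 2)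
  obtain ⟨s, hs, hs0⟩ := intermediate_value_Icc' hr hcont
    (show (0 : ℝ) ∈ Icc (1 - g r ^ 2) (1 - g 0 ^ 2) by
      rw [hg0]; exact ⟨by linarith, by nlinarith [hx.1, hx.2]⟩)
  exact hne s hs.1 hs0

lemma IsRegSolOn.hasDerivAt_Ham (h : IsRegSolOn a b φ x f g (Ici 0)) {r : ℝ} (hr : 0 < r) :
    HasDerivAt (fun r => Ham a b (f r) (g r))
      (-(2 * φ (f r) (g r) / r * f r ^ 2 * (1 - g r ^ 2))) r := by
  obtain ⟨hf, hg⟩ := h.2.2.2.2 r hr.le hr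
  unfold Ham
  exact (((((hf.pow 2).const_mul (1 / 2)).mul ((hg.pow 2).const_sub 1)).add
    ((hg.pow 4).const_mul (a / 4))).sub ((hg.pow 2).const_mul (b / 2))).congr_deriv
      (by simp only [Pi.pow_apply]; push_cast; ring)

lemma IsRegSolOn.antitoneOn_Ham (h : IsRegSolOn a b φ x f g (Ici 0)) (hx : x ∈ Ioo (0 : ℝ) 1)
    (hφ : IsCutoff a b η φ) : AntitoneOn (fun r => Ham a b (f r) (g r)) (Ici 0) := by
  refine antitoneOn_of_hasDerivWithinAt_nonpos (convex_Ici 0) ?_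
    (fun r hr => (h.hasDerivAt_Ham (by simpa using hr)).hasDerivWithinAt) (fun r hr => ?_)
  · have hf := h.2.2.1
    have hg := h.2.2.2.1
    unfold Ham
    fun_prop
  · have hr : 0 < r := by simpa using hr
    have h1 := h.sq_lt_one hx hr.le
    have h2 := (hφ.1 (f r) (g r)).1
    have h3 : 0 ≤ 1 - g r ^ 2 := by linarith
    have : 0 ≤ 2 * φ (f r) (g r) / r * f r ^ 2 * (1 - g r ^ 2) := by positivity
    linarith

lemma IsRegSolOn.sq_le (h : IsRegSolOn a b φ x f g (Ici 0)) (hx : x ∈ Ioo (0 : ℝ) 1)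
    (hb : 0 < b) (hab : 2 * b < a) (hφ : IsCutoff a b η φ) {r : ℝ} (hr : 0 ≤ r) :
    f r ^ 2 ≤ a - b := by
  have h1 := h.sq_lt_one hx hr
  have hH := h.antitoneOn_Ham hx hφ self_mem_Ici hr hr
  have h0 := Ham_sub a b (f 0) (g 0)
  have hrr := Ham_sub a b (f r) (g r)
  have hneg : (1 - x ^ 2) / 4 * (2 * 0 ^ 2 - a * x ^ 2 - (a - 2 * b)) ≤ 0 :=
    mul_nonpos_of_nonneg_of_nonpos (by nlinarith [hx.1, hx.2]) (by nlinarith [sq_nonneg x])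
  rw [h.1, h.2.1] at h0
  simp only [h.1, h.2.1] at hH
  have hle : (1 - g r ^ 2) / 4 * (2 * f r ^ 2 - a * g r ^ 2 - (a - 2 * b)) ≤ 0 := by linarith
  have := nonpos_of_mul_nonpos_right hle (by linarith)
  nlinarith

lemma IsRegSolOn.abs_le (h : IsRegSolOn a b φ x f g (Ici 0)) (hx : x ∈ Ioo (0 : ℝ) 1)
    (hb : 0 < b) (hab : 2 * b < a) (hφ : IsCutoff a b η φ) {r : ℝ} (hr : 0 ≤ r) :
    |f r| ≤ √(a - b) :=
  Real.abs_le_sqrt (h.sq_le hx hb hab hφ hr)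

lemma IsRegSolOn.abs_le_one (h : IsRegSolOn a b φ x f g (Ici 0)) (hx : x ∈ Ioo (0 : ℝ) 1)
    {r : ℝ} (hr : 0 ≤ r) : |g r| ≤ 1 :=
  (sq_le_one_iff_abs_le_one _).1 (h.sq_lt_one hx hr).le

lemma IsRegSolOn.abs_nonlinearity_le (h : IsRegSolOn a b φ x f g (Ici 0)) (hx : x ∈ Ioo (0 : ℝ) 1)
    (hb : 0 < b) (hab : 2 * b < a) (hφ : IsCutoff a b η φ) {r : ℝ} (hr : 0 ≤ r) :
    |f r ^ 2 - a * g r ^ 2 + b| ≤ 2 * a := by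
  have h1 := h.sq_lt_one hx hr
  have h2 := h.sq_le hx hb hab hφ hr
  rw [_root_.abs_le]
  constructor <;> nlinarith [sq_nonneg (f r), sq_nonneg (g r)]

/-- Quantitative smallness of `f` near the singular point `r = 0`, uniform in the solution. -/
lemma IsRegSolOn.sq_le_mul (h : IsRegSolOn a b φ x f g (Ici 0)) (hx : x ∈ Ioo (0 : ℝ) 1)
    (hb : 0 < b) (hab : 2 * b < a) (hφ : IsCutoff a b η φ) {r : ℝ} (hr : 0 ≤ r) :
    f r ^ 2 ≤ 4 * a * √(a - b) * r := by
  have hanti : AntitoneOn (fun r => f r ^ 2 - 4 * a * √(a - b) * r) (Ici 0) := by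
    refine antitoneOn_of_hasDerivWithinAt_nonpos (convex_Ici 0)
      ((h.2.2.1.pow 2).sub (by fun_prop))
      (fun r hr => (((h.2.2.2.2 r (interior_subset hr) (by simpa using hr)).1.pow 2).sub
        ((hasDerivAt_id r).const_mul (4 * a * √(a - b)))).hasDerivWithinAt) (fun r hr => ?_)
    have hr : 0 < r := by simpa using hr
    have hN := h.abs_nonlinearity_le hx hb hab hφ hr.le
    have hf := h.abs_le hx hb hab hφ hr.le
    have hg := h.abs_le_one hx hr.le
    have h2 := (hφ.1 (f r) (g r)).1
    have hdamp : 0 ≤ 2 * φ (f r) (g r) / r * f r ^ 2 := by positivity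
    have hmain : f r * g r * (f r ^ 2 - a * g r ^ 2 + b) ≤ √(a - b) * 1 * (2 * a) := by
      refine (le_abs_self _).trans ?_
      rw [abs_mul, abs_mul]
      have := sqrt_nonneg (a - b)
      gcongr
    push_cast
    simp only [pow_one, mul_one]
    nlinarith
  have := hanti self_mem_Ici hr hr
  simp only [h.1] at this
  linarith

/-- A solution never reaches the equilibrium `(0, 0)`. -/
lemma IsRegSolOn.ne_zero_of_eq_zero (h : IsRegSolOn a b φ x f g (Ici 0)) (hx : x ∈ Ioo (0 : ℝ) 1)
    (hb : 0 < b) (hab : 2 * b < a) (hφ : IsCutoff a b η φ) {r : ℝ} (hr : 0 < r) (hg : g r = 0) :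
    f r ≠ 0 := by
  intro hf
  have hzero : ∀ s ∈ Ioo 0 r, g s = 0 := by
    intro s hs
    have hsub : Icc s r ⊆ Ici 0 := fun _ ht => hs.1.le.trans ht.1
    have hE := mul_exp_le_of_le_hasDerivAt (E := fun t => f t ^ 2 + g t ^ 2)
      (C := 2 * a + 1 + 4 / s) hs.2.le
      (((h.2.2.1.mono hsub).pow 2).add ((h.2.2.2.1.mono hsub).pow 2))
      (fun t ht => ((h.2.2.2.2 t (hs.1.trans ht.1).le (hs.1.trans ht.1)).1.pow 2).add
        ((h.2.2.2.2 t (hs.1.trans ht.1).le (hs.1.trans ht.1)).2.pow 2))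
      (fun t ht => by
        have ht0 : 0 < t := hs.1.trans ht.1
        have hN := h.abs_nonlinearity_le hx hb hab hφ ht0.le
        have h1 := h.sq_lt_one hx ht0.le
        have h2 := hφ.1 (f t) (g t)
        have hdamp : φ (f t) (g t) / t * f t ^ 2 ≤ 1 / s * f t ^ 2 := by
          have := h2.1
          have := hs.1
          gcongr
          · exact h2.2
          · exact ht.1.le
        have hQ : |(f t ^ 2 - a * g t ^ 2 + b) + (1 - g t ^ 2)| ≤ 2 * a + 1 := by
          refine (abs_add_le _ _).trans (add_le_add hN ?_)
          rw [_root_.abs_le]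
          constructor <;> nlinarith [sq_nonneg (g t)]
        have hprod : |2 * (f t * g t) * ((f t ^ 2 - a * g t ^ 2 + b) + (1 - g t ^ 2))|
            ≤ (f t ^ 2 + g t ^ 2) * (2 * a + 1) := by
          rw [abs_mul]
          refine mul_le_mul ?_ hQ (abs_nonneg _) (by positivity)
          rw [_root_.abs_le]
          constructor <;> nlinarith [sq_nonneg (f t + g t), sq_nonneg (f t - g t)]
        have hlow := (_root_.abs_le.1 hprod).1
        have h4 : 0 ≤ 1 / s * g t ^ 2 := by have := hs.1; positivity
        push_cast
        simp only [pow_one]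
        have e1 : 2 * φ (f t) (g t) / t * f t = 2 * (φ (f t) (g t) / t * f t) := by ring
        have e2 : (4 : ℝ) / s = 4 * (1 / s) := by ring
        rw [e1, e2]
        nlinarith)
    simp only [hf, hg] at hE
    have hexp := exp_pos (-((2 * a + 1 + 4 / s) * (r - s)))
    have hle : f s ^ 2 + g s ^ 2 ≤ 0 := by
      refine nonpos_of_mul_nonpos_left ?_ hexp
      linarith
    have : g s ^ 2 = 0 := le_antisymm (by nlinarith [sq_nonneg (f s)]) (sq_nonneg _)
    simpa using this
  have hlim : Tendsto g (𝓝[>] 0) (𝓝 (g 0)) :=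
    (h.2.2.2.1 0 self_mem_Ici).mono_left (nhdsWithin_mono _ Ioi_subset_Ici_self)
  have hlim' : Tendsto g (𝓝[>] 0) (𝓝 0) := by
    refine tendsto_const_nhds.congr' ?_
    filter_upwards [Ioo_mem_nhdsGT hr] with s hs using (hzero s hs).symm
  have := tendsto_nhds_unique hlim hlim'
  rw [h.2.1] at this
  exact hx.1.ne' this

/-- Sign changes are exactly the positive zeros, since these are all simple. -/
lemma IsRegSolOn.changesSignAt_iff (h : IsRegSolOn a b φ x f g (Ici 0)) (hx : x ∈ Ioo (0 : ℝ) 1)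
    (hb : 0 < b) (hab : 2 * b < a) (hφ : IsCutoff a b η φ) {r : ℝ} :
    ChangesSignAt g (Ioi 0) r ↔ 0 < r ∧ g r = 0 := by
  constructor
  · rintro ⟨hg, ε, hε, hsub, -⟩
    exact ⟨hsub ⟨by linarith, by linarith⟩, hg⟩
  · rintro ⟨hr, hg⟩
    have hf := h.ne_zero_of_eq_zero hx hb hab hφ hr hg
    have hderiv := (h.2.2.2.2 r hr.le hr).2
    rw [hg] at hderiv
    have hsq : ∀ᶠ s in 𝓝[≠] r, 0 < f r * ((s - r)⁻¹ * g s) := by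
      have := (hasDerivAt_iff_tendsto_slope.1 hderiv).const_mul (f r)
      have hev := this.eventually (lt_mem_nhds (show 0 < f r * (f r * (1 - 0 ^ 2)) by
        have := mul_self_pos.2 hf
        linarith))
      simpa [slope_def_field, hg, div_eq_inv_mul] using hev
    obtain ⟨δ, hδ, hball⟩ := Metric.mem_nhdsWithin_iff.1 hsq
    have hneg : ∀ s, 0 < s → s < δ → g (r - s) * g (r + s) < 0 := by
      intro s hs hsδ
      have h1 := hball (show r - s ∈ Metric.ball r δ ∩ {r}ᶜ by
        simp [abs_of_pos hs, hsδ, hs.ne'])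
      have h2 := hball (show r + s ∈ Metric.ball r δ ∩ {r}ᶜ by
        simp [abs_of_pos hs, hsδ, hs.ne'])
      simp only [mem_ofPred_eq] at h1 h2
      have h3 := mul_pos h1 h2
      have e : f r * ((r - s - r)⁻¹ * g (r - s)) * (f r * ((r + s - r)⁻¹ * g (r + s)))
          = -((f r / s) ^ 2 * (g (r - s) * g (r + s))) := by
        rw [show r - s - r = -s by ring, show r + s - r = s by ring]
        field_simp
      rw [e] at h3
      by_contra hcon
      push Not at hcon
      nlinarith [mul_nonneg (sq_nonneg (f r / s)) hcon]
    have hm : 0 < min δ r := lt_min hδ hr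
    refine ⟨hg, min δ r / 2, by positivity, fun s hs => ?_, hneg _ (by positivity) ?_, ?_⟩
    · have := min_le_right δ r
      exact mem_Ioi.2 (by linarith [hs.1])
    · linarith [min_le_left δ r]
    · exact fun s hs => (hneg s hs.1 (by linarith [hs.2, min_le_left δ r])).le

lemma IsRegSolOn.exists_tendsto_Ham (h : IsRegSolOn a b φ x f g (Ici 0)) (hx : x ∈ Ioo (0 : ℝ) 1)
    (hb : 0 < b) (hab : 2 * b < a) (hφ : IsCutoff a b η φ) {R : ℝ} (hR : 0 ≤ R)
    (hneg : Ham a b (f R) (g R) < 0) :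
    ∃ L, L < 0 ∧ Tendsto (fun r => Ham a b (f r) (g r)) atTop (𝓝 L) := by
  have hanti := h.antitoneOn_Ham hx hφ
  have hmono : Antitone fun r => Ham a b (f (max r 0)) (g (max r 0)) := fun r s hrs =>
    hanti (mem_Ici.2 (le_max_right _ _)) (mem_Ici.2 (le_max_right _ _)) (max_le_max_right 0 hrs)
  have hbdd : BddBelow (range fun r => Ham a b (f (max r 0)) (g (max r 0))) := by
    refine ⟨-(b / 2), ?_⟩
    rintro _ ⟨r, rfl⟩
    have h1 := h.sq_lt_one hx (le_max_right r 0)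
    simp only [Ham]
    have h2 : 0 ≤ f (max r 0) ^ 2 * (1 - g (max r 0) ^ 2) :=
      mul_nonneg (sq_nonneg _) (by linarith)
    have h3 : 0 ≤ g (max r 0) ^ 4 := by positivity
    nlinarith
  refine ⟨_, ?_, (tendsto_atTop_ciInf hmono hbdd).congr' ?_⟩
  · refine (ciInf_le hbdd R).trans_lt ?_
    rwa [max_eq_left hR]
  · filter_upwards [eventually_ge_atTop 0] with r hr
    rw [max_eq_left hr]

lemma IsRegSolOn.ne_zero_of_Ham_neg (h : IsRegSolOn a b φ x f g (Ici 0)) (hx : x ∈ Ioo (0 : ℝ) 1)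
    (hφ : IsCutoff a b η φ) {R r : ℝ} (hR : 0 ≤ R) (hneg : Ham a b (f R) (g R) < 0)
    (hRr : R ≤ r) : g r ≠ 0 := by
  intro hg
  have := h.antitoneOn_Ham hx hφ hR (hR.trans hRr) hRr
  simp only [Ham, hg] at this hneg
  nlinarith [sq_nonneg (f r)]

/-- Where `f` has a fixed sign, `g` is strictly monotone. -/
lemma IsRegSolOn.strictMonoOn (h : IsRegSolOn a b φ x f g (Ici 0)) (hx : x ∈ Ioo (0 : ℝ) 1)
    {p q c : ℝ} (hp : 0 < p) (hc : ∀ r ∈ Icc p q, 0 < f r * c) :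
    StrictMonoOn (fun r => c * g r) (Icc p q) := by
  have hsub : Icc p q ⊆ Ici 0 := fun _ hs => hp.le.trans hs.1
  refine strictMonoOn_of_deriv_pos (convex_Icc p q)
    (continuousOn_const.mul (h.2.2.2.1.mono hsub)) (fun r hr => ?_)
  rw [interior_Icc] at hr
  have hr0 : 0 < r := hp.trans hr.1
  rw [((h.2.2.2.2 r hr0.le hr0).2.const_mul c).deriv]
  have := mul_pos (hc r ⟨hr.1.le, hr.2.le⟩) (sub_pos.2 (h.sq_lt_one hx hr0.le))
  linarith

end Solution

section Dependence

variable {a b η : ℝ} {φ : ℝ → ℝ → ℝ}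

/-- Lipschitz dependence on the initial datum, uniform on compact intervals. -/
lemma IsRegSolOn.exists_dist_sq_le (hb : 0 < b) (hab : 2 * b < a)
    (hη : η ∈ Ioo 0 (√(a - b) - √(a / 2))) (hφ : IsCutoff a b η φ) :
    ∃ C, 0 ≤ C ∧ ∀ x y f₁ g₁ f₂ g₂, x ∈ Ioo (0 : ℝ) 1 → y ∈ Ioo (0 : ℝ) 1 →
      IsRegSolOn a b φ x f₁ g₁ (Ici 0) → IsRegSolOn a b φ y f₂ g₂ (Ici 0) →
      ∀ r, 0 ≤ r → (f₁ r - f₂ r) ^ 2 + (g₁ r - g₂ r) ^ 2 ≤ (x - y) ^ 2 * exp (C * r) := by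
  have hM : 0 < √(a - b) - η := by linarith [hη.2, sqrt_nonneg (a / 2)]
  have hM' : 0 < √(a - b) := by linarith [hη.1]
  have hφc := hφ.contDiff hη.1
  obtain ⟨LN, hLN, hN⟩ := ContDiff.exists_box_lipschitz
    (h := fun p => p.2 * (p.1 ^ 2 - a * p.2 ^ 2 + b)) (by fun_prop) √(a - b)
  obtain ⟨LP, hLP, hP⟩ := ContDiff.exists_box_lipschitz
    (h := fun p => p.1 * (1 - p.2 ^ 2)) (by fun_prop) √(a - b)
  obtain ⟨LF, hLF, hF⟩ := ContDiff.exists_box_lipschitz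
    (h := fun p => φ p.1 p.2 * p.1) (by fun_prop) √(a - b)
  obtain ⟨r₀, hr₀, hr₀'⟩ : ∃ r₀ > 0, 4 * a * √(a - b) * r₀ = (√(a - b) - η) ^ 2 := by
    have ha : 0 < a := by linarith
    exact ⟨(√(a - b) - η) ^ 2 / (4 * a * √(a - b)), by positivity, by field_simp⟩
  have hφ1 : ∀ x f g, x ∈ Ioo (0 : ℝ) 1 → IsRegSolOn a b φ x f g (Ici 0) →
      ∀ r, 0 ≤ r → r ≤ r₀ → φ (f r) (g r) = 1 := by
    intro x f g hx h r hr hrr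
    refine hφ.2.2.2.2 _ _ (abs_le_of_sq_le_sq ?_ hM.le)
    have hpos : 0 ≤ 4 * a * √(a - b) := by
      have : 0 < a := by linarith
      positivity
    exact (h.sq_le_mul hx hb hab hφ hr).trans
      (hr₀' ▸ mul_le_mul_of_nonneg_left hrr hpos)
  refine ⟨2 * LN + 2 * LP + 4 / r₀ * LF, by positivity, ?_⟩
  intro x y f₁ g₁ f₂ g₂ hx hy h₁ h₂ r hr
  have hsub : Icc 0 r ⊆ Ici 0 := fun _ hs => hs.1
  have key := le_mul_exp_of_hasDerivAt_le
    (E := fun r => (f₁ r - f₂ r) ^ 2 + (g₁ r - g₂ r) ^ 2)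
    (C := 2 * LN + 2 * LP + 4 / r₀ * LF) hr
    ((((h₁.2.2.1.sub h₂.2.2.1).mono hsub).pow 2).add
      (((h₁.2.2.2.1.sub h₂.2.2.2.1).mono hsub).pow 2))
    (fun s hs => (((h₁.2.2.2.2 s hs.1.le hs.1).1.sub (h₂.2.2.2.2 s hs.1.le hs.1).1).pow 2).add
      (((h₁.2.2.2.2 s hs.1.le hs.1).2.sub (h₂.2.2.2.2 s hs.1.le hs.1).2).pow 2))
    (fun s hs => by
      have hf₁ := h₁.abs_le hx hb hab hφ hs.1.le
      have hf₂ := h₂.abs_le hy hb hab hφ hs.1.le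
      have hg₁ := h₁.abs_le_one hx hs.1.le
      have hg₂ := h₂.abs_le_one hy hs.1.le
      have b1 := (_root_.abs_le.1 (hN _ _ _ _ (f₁ s - f₂ s) hf₁ hg₁ hf₂ hg₂ (le_max_left _ _))).2
      have b2 := (_root_.abs_le.1 (hP _ _ _ _ (g₁ s - g₂ s) hf₁ hg₁ hf₂ hg₂ (le_max_right _ _))).2
      have b3 : -(4 / s * ((f₁ s - f₂ s) * (φ (f₁ s) (g₁ s) * f₁ s - φ (f₂ s) (g₂ s) * f₂ s)))
          ≤ 4 / r₀ * (LF * ((f₁ s - f₂ s) ^ 2 + (g₁ s - g₂ s) ^ 2)) := by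
        have hs0 := hs.1
        rcases le_total s r₀ with hsr | hsr
        · rw [hφ1 x f₁ g₁ hx h₁ s hs.1.le hsr, hφ1 y f₂ g₂ hy h₂ s hs.1.le hsr]
          have p1 : 0 ≤ 4 / s * (f₁ s - f₂ s) ^ 2 := by positivity
          have p2 : 0 ≤ 4 / r₀ * (LF * ((f₁ s - f₂ s) ^ 2 + (g₁ s - g₂ s) ^ 2)) := by positivity
          linarith
        · have hb3 := hF _ _ _ _ (f₁ s - f₂ s) hf₁ hg₁ hf₂ hg₂ (le_max_left _ _)
          rw [← mul_neg]
          refine (mul_le_mul_of_nonneg_left ((neg_le_abs _).trans hb3) (by positivity)).trans ?_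
          gcongr
      push_cast
      simp only [pow_one]
      have e : ∀ p q u₁ u₂ : ℝ, 2 * (f₁ s - f₂ s) * (p - 2 * u₁ / s * f₁ s - (q - 2 * u₂ / s * f₂ s))
          = 2 * ((f₁ s - f₂ s) * (p - q)) + -(4 / s * ((f₁ s - f₂ s) * (u₁ * f₁ s - u₂ * f₂ s))) := by
        intros; ring
      simp only [Pi.sub_apply]
      rw [e]
      linarith)
  simpa [h₁.1, h₁.2.1, h₂.1, h₂.2.1] using key

lemma IsRegSolOn.eventually_close (hb : 0 < b) (hab : 2 * b < a)
    (hη : η ∈ Ioo 0 (√(a - b) - √(a / 2))) (hφ : IsCutoff a b η φ) {F G : ℝ → ℝ → ℝ}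
    (hFG : ∀ y ∈ Ioo (0 : ℝ) 1, IsRegSolOn a b φ y (F y) (G y) (Ici 0))
    {x : ℝ} (hx : x ∈ Ioo (0 : ℝ) 1) (R : ℝ) {ε : ℝ} (hε : 0 < ε) :
    ∀ᶠ y in 𝓝 x, ∀ r ∈ Icc 0 R, |F y r - F x r| < ε ∧ |G y r - G x r| < ε := by
  obtain ⟨C, hC, hdist⟩ := IsRegSolOn.exists_dist_sq_le hb hab hη hφ
  have hlim : Tendsto (fun y : ℝ => (y - x) ^ 2 * exp (C * R)) (𝓝 x) (𝓝 0) := by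
    have : Continuous fun y : ℝ => (y - x) ^ 2 * exp (C * R) := by fun_prop
    simpa using this.tendsto x
  filter_upwards [hlim.eventually (gt_mem_nhds (show 0 < ε ^ 2 by positivity)),
    isOpen_Ioo.mem_nhds hx] with y hy hy' r hr
  have h1 := hdist y x _ _ _ _ hy' hx (hFG y hy') (hFG x hx) r hr.1
  have h2 : (y - x) ^ 2 * exp (C * r) ≤ (y - x) ^ 2 * exp (C * R) := by
    have := hr.2
    gcongr
  constructor <;> refine abs_lt_of_sq_lt_sq ?_ hε.le
  · nlinarith [sq_nonneg (G y r - G x r)]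
  · nlinarith [sq_nonneg (F y r - F x r)]

lemma IsRegSolOn.tendsto_param (hb : 0 < b) (hab : 2 * b < a)
    (hη : η ∈ Ioo 0 (√(a - b) - √(a / 2))) (hφ : IsCutoff a b η φ) {F G : ℝ → ℝ → ℝ}
    (hFG : ∀ y ∈ Ioo (0 : ℝ) 1, IsRegSolOn a b φ y (F y) (G y) (Ici 0))
    {x : ℝ} (hx : x ∈ Ioo (0 : ℝ) 1) {r : ℝ} (hr : 0 ≤ r) :
    Tendsto (fun y => F y r) (𝓝 x) (𝓝 (F x r)) ∧ Tendsto (fun y => G y r) (𝓝 x) (𝓝 (G x r)) := by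
  constructor <;> refine Metric.tendsto_nhds.2 fun ε hε => ?_ <;>
    filter_upwards [IsRegSolOn.eventually_close hb hab hη hφ hFG hx r hε] with y hy
  · exact (hy r ⟨hr, le_rfl⟩).1
  · exact (hy r ⟨hr, le_rfl⟩).2

/-- Nearby solutions have as many positive zeros as the given one. -/
lemma IsRegSolOn.eventually_zeros (hb : 0 < b) (hab : 2 * b < a)
    (hη : η ∈ Ioo 0 (√(a - b) - √(a / 2))) (hφ : IsCutoff a b η φ) {F G : ℝ → ℝ → ℝ}
    (hFG : ∀ y ∈ Ioo (0 : ℝ) 1, IsRegSolOn a b φ y (F y) (G y) (Ici 0))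
    {x : ℝ} (hx : x ∈ Ioo (0 : ℝ) 1) {R : ℝ} (hR : 0 ≤ R)
    (hneg : ∀ᶠ y in 𝓝 x, Ham a b (F y R) (G y R) < 0)
    (hfin : {r | 0 < r ∧ G x r = 0}.Finite) :
    ∀ᶠ y in 𝓝 x, ∃ e : ℝ → ℝ, InjOn e {r | 0 < r ∧ G x r = 0} ∧
      {r | 0 < r ∧ G y r = 0} = e '' {r | 0 < r ∧ G x r = 0} := by
  set Z := {r | 0 < r ∧ G x r = 0} with hZ
  have hsolx := hFG x hx
  have hδ : ∀ᶠ δ in 𝓝[>] (0 : ℝ), ∀ z ∈ Z, ∀ r ∈ Icc (z - 2 * δ) (z + 2 * δ),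
      0 < r ∧ 0 < F x r * F x z := by
    refine (eventually_all_finite hfin).2 fun z hz => ?_
    have hF0 := hsolx.ne_zero_of_eq_zero hx hb hab hφ hz.1 hz.2
    have hcont : ContinuousAt (F x) z := (hsolx.2.2.2.2 z hz.1.le hz.1).1.continuousAt
    have hev : ∀ᶠ r in 𝓝 z, 0 < r ∧ 0 < F x r * F x z :=
      (lt_mem_nhds hz.1).and ((hcont.mul continuousAt_const).eventually
        (lt_mem_nhds (mul_self_pos.2 hF0)))
    obtain ⟨ε, hε, hball⟩ := Metric.eventually_nhds_iff.1 hev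
    filter_upwards [Ioo_mem_nhdsGT (show (0 : ℝ) < ε / 2 by positivity)] with δ hδ r hr
    refine hball (abs_lt.2 ⟨?_, ?_⟩) <;> linarith [hr.1, hr.2, hδ.2]
  obtain ⟨δ, hδZ, hδ0⟩ := (hδ.and self_mem_nhdsWithin).exists
  replace hδ0 : 0 < δ := hδ0
  have hsmall : ∀ z, Icc (z - δ) (z + δ) ⊆ Icc (z - 2 * δ) (z + 2 * δ) := fun z =>
    Icc_subset_Icc (by linarith) (by linarith)
  have hxmono : ∀ z ∈ Z, StrictMonoOn (fun r => F x z * G x r) (Icc (z - 2 * δ) (z + 2 * δ)) :=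
    fun z hz => hsolx.strictMonoOn hx (hδZ z hz _ ⟨le_rfl, by linarith⟩).1
      fun r hr => (hδZ z hz r hr).2
  have hfar : ∀ᶠ y in 𝓝 x, ∀ r ∈ Icc 0 R, (∀ z ∈ Z, δ ≤ |r - z|) → G y r ≠ 0 := by
    have hK : IsCompact (Icc 0 R ∩ ⋂ z ∈ Z, {r : ℝ | δ ≤ |r - z|}) :=
      isCompact_Icc.inter_right (isClosed_biInter fun z _ =>
        isClosed_le continuous_const (by fun_prop))
    obtain ⟨m, hm, hmle⟩ := hK.exists_forall_le' (f := fun r => |G x r|) (a := 0)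
      (hsolx.2.2.2.1.abs.mono fun r hr => hr.1.1) (fun r hr => by
        refine abs_pos.2 fun h0 => ?_
        rcases hr.1.1.eq_or_lt with h | h
        · rw [← h, hsolx.2.1] at h0
          exact hx.1.ne' h0
        · have := mem_iInter₂.1 hr.2 r ⟨h, h0⟩
          simp only [mem_ofPred_eq, sub_self, abs_zero] at this
          linarith)
    filter_upwards [IsRegSolOn.eventually_close hb hab hη hφ hFG hx R hm] with y hy r hr hrZ h0
    have h1 := (hy r hr).2
    have h2 := hmle r ⟨hr, mem_iInter₂.2 hrZ⟩
    rw [h0, zero_sub, abs_neg] at h1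
    linarith
  have hnear : ∀ᶠ y in 𝓝 x, ∀ z ∈ Z, F x z * G y (z - δ) < 0 ∧ 0 < F x z * G y (z + δ) ∧
      ∀ r ∈ Icc (z - δ) (z + δ), 0 < F y r * F x z := by
    refine (eventually_all_finite hfin).2 fun z hz => ?_
    have hl : z - δ ∈ Icc (z - 2 * δ) (z + 2 * δ) := ⟨by linarith, by linarith⟩
    have hm : z ∈ Icc (z - 2 * δ) (z + 2 * δ) := ⟨by linarith, by linarith⟩
    have hr : z + δ ∈ Icc (z - 2 * δ) (z + 2 * δ) := ⟨by linarith, by linarith⟩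
    have hlt := hxmono z hz hl hm (by linarith)
    have hgt := hxmono z hz hm hr (by linarith)
    simp only [hz.2, mul_zero] at hlt hgt
    have htl := (IsRegSolOn.tendsto_param hb hab hη hφ hFG hx (hδZ z hz _ hl).1.le).2
    have htr := (IsRegSolOn.tendsto_param hb hab hη hφ hFG hx (hδZ z hz _ hr).1.le).2
    have hF0 := hsolx.ne_zero_of_eq_zero hx hb hab hφ hz.1 hz.2
    obtain ⟨m, hm, hmle⟩ := (isCompact_Icc (a := z - δ) (b := z + δ)).exists_forall_le'
      (f := fun r => F x r * F x z) (a := 0)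
      ((hsolx.2.2.1.mono fun r hr => (hδZ z hz r (hsmall z hr)).1.le).mul continuousOn_const)
      (fun r hr => (hδZ z hz r (hsmall z hr)).2)
    have hFz : 0 < |F x z| := abs_pos.2 hF0
    filter_upwards [(htl.const_mul (F x z)).eventually (gt_mem_nhds hlt),
      (htr.const_mul (F x z)).eventually (lt_mem_nhds hgt),
      IsRegSolOn.eventually_close hb hab hη hφ hFG hx (z + δ)
        (show 0 < m / |F x z| by positivity)] with y h1 h2 h3
    refine ⟨h1, h2, fun r hr => ?_⟩
    have h4 := (h3 r ⟨(hδZ z hz r (hsmall z hr)).1.le, hr.2⟩).1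
    rw [lt_div_iff₀ hFz, ← abs_mul] at h4
    have h5 := (_root_.abs_lt.1 h4).1
    have h6 := hmle r hr
    linarith
  filter_upwards [hneg, hfar, hnear, isOpen_Ioo.mem_nhds hx] with y hyneg hyfar hynear hy
  have hsoly := hFG y hy
  have hymono : ∀ z ∈ Z, StrictMonoOn (fun r => F x z * G y r) (Icc (z - δ) (z + δ)) :=
    fun z hz => hsoly.strictMonoOn hy (hδZ z hz _ (hsmall z ⟨le_rfl, by linarith⟩)).1
      (hynear z hz).2.2
  have hex : ∀ z ∈ Z, ∃ w ∈ Icc (z - δ) (z + δ), G y w = 0 := by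
    intro z hz
    obtain ⟨hl, hr, -⟩ := hynear z hz
    obtain ⟨w, hw, hw0⟩ := intermediate_value_Icc (show z - δ ≤ z + δ by linarith)
      (f := fun r => F x z * G y r) (continuousOn_const.mul (hsoly.2.2.2.1.mono
        fun r hr => (hδZ z hz r (hsmall z hr)).1.le)) ⟨hl.le, hr.le⟩
    exact ⟨w, hw, (mul_eq_zero.1 hw0).resolve_left
      (hsolx.ne_zero_of_eq_zero hx hb hab hφ hz.1 hz.2)⟩
  choose! e heI he0 using hex
  refine ⟨e, fun z hz z' hz' hzz => ?_, Subset.antisymm (fun w hw => ?_) ?_⟩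
  · have h1 := heI z hz
    have h2 := heI z' hz'
    rw [← hzz] at h2
    exact (hxmono z hz).injOn ⟨by linarith, by linarith⟩
      ⟨by linarith [h1.1, h2.2], by linarith [h1.2, h2.1]⟩ (by simp only [hz.2, hz'.2])
  · have hwR : w < R := by
      by_contra hcon
      exact hsoly.ne_zero_of_Ham_neg hy hφ hR hyneg (not_lt.1 hcon) hw.2
    obtain ⟨z, hz, hwz⟩ : ∃ z ∈ Z, |w - z| < δ := by
      by_contra! hcon
      exact hyfar w ⟨hw.1.le, hwR.le⟩ hcon hw.2
    have hwz' := _root_.abs_lt.1 hwz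
    exact ⟨z, hz, (hymono z hz).injOn (heI z hz) ⟨by linarith, by linarith⟩
      (by simp only [he0 z hz, hw.2])⟩
  · rintro _ ⟨z, hz, rfl⟩
    exact ⟨(hδZ z hz _ (hsmall z (heI z hz))).1, he0 z hz⟩

end Dependence


/-- Lemma 2.8 (i): the set `A_k` is open. -/
theorem Aset_isOpen (a b η : ℝ) (hb : 0 < b) (hab : 2 * b < a)
    (hη : η ∈ Ioo 0 (Real.sqrt (a - b) - Real.sqrt (a / 2)))
    (φ : ℝ → ℝ → ℝ) (hφ : IsCutoff a b η φ)
    (F G : ℝ → ℝ → ℝ)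
    (hFG : ∀ y ∈ Ioo (0 : ℝ) 1, IsRegSolOn a b φ y (F y) (G y) (Ici 0))
    (k : ℕ) :
    IsOpen (Aset a b F G k) := by
  have hsc : ∀ y ∈ Ioo (0 : ℝ) 1,
      {r | ChangesSignAt (G y) (Ioi 0) r} = {r | 0 < r ∧ G y r = 0} := fun y hy =>
    ext fun r => (hFG y hy).changesSignAt_iff hy hb hab hφ
  rw [isOpen_iff_mem_nhds]
  rintro x ⟨hx, ⟨L, hL, hlim⟩, hfin, hcard⟩
  rw [hsc x hx] at hfin hcard
  obtain ⟨R, hRneg, hR⟩ := ((hlim.eventually (gt_mem_nhds hL)).and (eventually_ge_atTop 0)).exists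
  have hneg : ∀ᶠ y in 𝓝 x, Ham a b (F y R) (G y R) < 0 := by
    obtain ⟨hF, hG⟩ := IsRegSolOn.tendsto_param hb hab hη hφ hFG hx hR
    refine Tendsto.eventually ?_ (gt_mem_nhds hRneg)
    exact (((hF.pow 2).const_mul (1 / 2)).mul ((hG.pow 2).const_sub 1)).add
      ((hG.pow 4).const_mul (a / 4)) |>.sub ((hG.pow 2).const_mul (b / 2))
  filter_upwards [isOpen_Ioo.mem_nhds hx, hneg,
    IsRegSolOn.eventually_zeros hb hab hη hφ hFG hx hR hneg hfin] with y hy hyneg ⟨e, he, hZ⟩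
  refine ⟨hy, (hFG y hy).exists_tendsto_Ham hy hb hab hφ hR hyneg, ?_⟩
  rw [ChangesSignExactly, hsc y hy, hZ]
  exact ⟨hfin.image e, by rw [he.ncard_image, hcard]⟩
end
end
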